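/- arXiv:1601.05138 — 2 statements merged into one kernel-verified Lean document; each statement's English description precedes it below -/
import Mathlib

section
/- Let ρ : ℝ×ℝ³ → ℝ be smooth and compactly supported with ∫ρ dz = 1, ρ_ε(t,x) = ε^{−5}ρ(t/ε², x/ε). Let K : ℝ×ℝ³ → ℝ be smooth away from the origin, compactly supported, with K(z) = P(z) for all z with 0 < ‖z‖ ≤ 1/2 and |D^ℓK(z)| ≤ C_ℓ·‖z‖^{−3−|ℓ|} for all z ≠ 0. Set K_ε = K*ρ_ε and G_ε = K_ε*K_ε. Then there exist constants c₂ > 0 and C such that the renormalisation constant C₂^{(ε)} = ∫ K(z)·G_ε(z)² dz satisfies |C₂^{(ε)} − c₂·log(1/ε)| ≤ C for all ε ∈ (0,1/2]. -/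
open MeasureTheory

/-- The parabolic norm on space-time `ℝ×ℝ³` (coordinates `z 0 = t`, `z 1, z 2, z 3 = x`):
`‖z‖ = |t|^{1/2} + |x|`. -/
noncomputable def pnorm (z : Fin 4 → ℝ) : ℝ :=
  Real.sqrt |z 0| + Real.sqrt ((z 1) ^ 2 + (z 2) ^ 2 + (z 3) ^ 2)

/-- The parabolic degree `|ℓ| = 2ℓ₀ + ℓ₁ + ℓ₂ + ℓ₃` of a multi-index. -/
def pdeg (l : Fin 4 → ℕ) : ℕ := 2 * l 0 + l 1 + l 2 + l 3

/-- Partial derivative in the `i`-th coordinate direction. -/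
noncomputable def pd (i : Fin 4) (f : (Fin 4 → ℝ) → ℝ) : (Fin 4 → ℝ) → ℝ :=
  fun z => fderiv ℝ f z (Pi.single i 1)

/-- The multi-index derivative `D^ℓ = ∂_t^{ℓ₀}∂_{x₁}^{ℓ₁}∂_{x₂}^{ℓ₂}∂_{x₃}^{ℓ₃}`. -/
noncomputable def Dmulti (l : Fin 4 → ℕ) (f : (Fin 4 → ℝ) → ℝ) : (Fin 4 → ℝ) → ℝ :=
  (pd 0)^[l 0] ((pd 1)^[l 1] ((pd 2)^[l 2] ((pd 3)^[l 3] f)))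

/-- The parabolic rescaling `φ_ε(t,x) = ε⁻⁵ φ(t/ε², x/ε)`. -/
noncomputable def parRescale (ε : ℝ) (φ : (Fin 4 → ℝ) → ℝ) : (Fin 4 → ℝ) → ℝ :=
  fun z => (ε ^ 5)⁻¹ * φ (fun i => if i = 0 then z 0 / ε ^ 2 else z i / ε)

/-- Space-time convolution `(f*g)(z) = ∫ f(z−w)g(w) dw`. -/
noncomputable def stConv (f g : (Fin 4 → ℝ) → ℝ) : (Fin 4 → ℝ) → ℝ :=
  fun z => ∫ w : Fin 4 → ℝ, f (z - w) * g w

/-- The heat kernel on `ℝ³`, as a function on space-time `ℝ×ℝ³`. -/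
noncomputable def heatP (z : Fin 4 → ℝ) : ℝ :=
  if 0 < z 0 then
    (4 * Real.pi * z 0) ^ (-(3 : ℝ) / 2) *
      Real.exp (-((z 1) ^ 2 + (z 2) ^ 2 + (z 3) ^ 2) / (4 * z 0))
  else 0

section Gaussian

open ProbabilityTheory NNReal

lemma gaussProd_integral (m : Fin 3 → ℝ) {v : ℝ≥0} (hv : v ≠ 0) :
    ∫ x : Fin 3 → ℝ, ∏ i, gaussianPDFReal (m i) v (x i) = 1 := by
  rw [integral_fintype_prod_volume_eq_prod (fun i => gaussianPDFReal (m i) v)]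
  simp [integral_gaussianPDFReal_eq_one _ hv]

lemma gaussProd_integrable (m : Fin 3 → ℝ) (v : ℝ≥0) :
    Integrable (fun x : Fin 3 → ℝ => ∏ i, gaussianPDFReal (m i) v (x i)) :=
  Integrable.fintype_prod (f := fun i => gaussianPDFReal (m i) v)
    (fun i => integrable_gaussianPDFReal (m i) v)

lemma gaussProd_nonneg (m : Fin 3 → ℝ) (v : ℝ≥0) (x : Fin 3 → ℝ) :
    0 ≤ ∏ i, gaussianPDFReal (m i) v (x i) :=
  Finset.prod_nonneg fun _ _ => gaussianPDFReal_nonneg _ _ _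

lemma measurable_gaussProd {α : Type*} [MeasurableSpace α] {v : α → ℝ≥0} {m x : α → Fin 3 → ℝ}
    (hv : Measurable v) (hm : Measurable m) (hx : Measurable x) :
    Measurable fun a => ∏ i, gaussianPDFReal (m a i) (v a) (x a i) := by
  refine Finset.measurable_prod _ fun i _ => ?_
  exact measurable_uncurry_gaussianPDFReal.comp
    (((measurable_pi_apply i).comp hm).prodMk (hv.prodMk ((measurable_pi_apply i).comp hx)))

/-- Integration against a time-dependent Gaussian kernel only sees the time weight. -/
lemma integral_time_weight {v : ℝ → ℝ≥0} {m : ℝ → Fin 3 → ℝ} {w : ℝ → ℝ}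
    (hv : Measurable v) (hm : Measurable m) (hw : Integrable w)
    (hvw : ∀ t, w t ≠ 0 → v t ≠ 0) :
    Integrable (fun z : Fin 4 → ℝ =>
      w (z 0) * ∏ i : Fin 3, gaussianPDFReal (m (z 0) i) (v (z 0)) (z i.succ)) ∧
    ∫ z : Fin 4 → ℝ, w (z 0) * ∏ i : Fin 3, gaussianPDFReal (m (z 0) i) (v (z 0)) (z i.succ)
      = ∫ t, w t := by
  have hmp := volume_preserving_piFinSuccAbove (fun _ : Fin 4 => ℝ) 0
  set e := MeasurableEquiv.piFinSuccAbove (fun _ : Fin 4 => ℝ) 0 with he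
  let F : ℝ × (Fin 3 → ℝ) → ℝ := fun p =>
    w p.1 * ∏ i : Fin 3, gaussianPDFReal (m p.1 i) (v p.1) (p.2 i)
  have hF : (fun z : Fin 4 → ℝ =>
      w (z 0) * ∏ i : Fin 3, gaussianPDFReal (m (z 0) i) (v (z 0)) (z i.succ)) = F ∘ e := by
    funext z
    simp [F, he, MeasurableEquiv.piFinSuccAbove, Fin.insertNthEquiv, Fin.tail]
  have hslice : ∀ t, ∫ x, F (t, x) = w t := by
    intro t
    simp only [F]
    rw [integral_const_mul]
    by_cases h : w t = 0
    · simp [h]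
    · rw [gaussProd_integral _ (hvw t h), mul_one]
  have hFint : Integrable F := by
    have hmeas : AEStronglyMeasurable F (volume : Measure (ℝ × (Fin 3 → ℝ))) := by
      refine AEStronglyMeasurable.mul hw.aestronglyMeasurable.comp_fst ?_
      exact (measurable_gaussProd (hv.comp measurable_fst) (hm.comp measurable_fst)
        measurable_snd).aestronglyMeasurable
    rw [Measure.volume_eq_prod] at hmeas ⊢
    rw [integrable_prod_iff hmeas]
    refine ⟨Filter.Eventually.of_forall fun t => (gaussProd_integrable (m t) (v t)).const_mul (w t), ?_⟩
    refine hw.norm.congr (Filter.Eventually.of_forall fun t => ?_)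
    simp only [F, norm_mul, Real.norm_of_nonneg (gaussProd_nonneg _ _ _)]
    rw [integral_const_mul]
    by_cases h : w t = 0
    · simp [h]
    · rw [gaussProd_integral _ (hvw t h), mul_one]
  rw [hF]
  refine ⟨hmp.integrable_comp_of_integrable hFint, ?_⟩
  have h1 := hmp.integral_comp e.measurableEmbedding F
  simp only [Function.comp_def]
  rw [h1]
  rw [Measure.volume_eq_prod] at hFint ⊢
  rw [integral_prod _ hFint]
  simp [hslice]

lemma heatP_eq_gaussProd (z : Fin 4 → ℝ) :
    heatP z = ∏ i : Fin 3, gaussianPDFReal 0 (2 * z 0).toNNReal (z i.succ) := by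
  unfold heatP
  split_ifs with h
  · have h2 : ((2 * z 0).toNNReal : ℝ) = 2 * z 0 := Real.coe_toNNReal _ (by positivity)
    have e4 : 2 * Real.pi * (2 * z 0) = 4 * Real.pi * z 0 := by ring
    have hp : 0 < 4 * Real.pi * z 0 := by positivity
    simp only [gaussianPDFReal, h2, e4, Fin.prod_univ_three, sub_zero]
    have hr : (4 * Real.pi * z 0) ^ (-(3 : ℝ) / 2) = (√(4 * Real.pi * z 0))⁻¹ ^ 3 := by
      rw [Real.sqrt_eq_rpow, ← Real.rpow_neg hp.le, ← Real.rpow_natCast, ← Real.rpow_mul hp.le]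
      norm_num
    have hx : -((z 1) ^ 2 + (z 2) ^ 2 + (z 3) ^ 2) / (4 * z 0) =
        -(z 1) ^ 2 / (2 * (2 * z 0)) + -(z 2) ^ 2 / (2 * (2 * z 0))
          + -(z 3) ^ 2 / (2 * (2 * z 0)) := by
      field_simp; ring
    rw [hr, hx, Real.exp_add, Real.exp_add]
    have a1 : Fin.succ (0 : Fin 3) = 1 := rfl
    have a2 : Fin.succ (1 : Fin 3) = 2 := rfl
    have a3 : Fin.succ (2 : Fin 3) = 3 := rfl
    rw [a1, a2, a3]
    ring
  · have : (2 * z 0).toNNReal = 0 := Real.toNNReal_of_nonpos (by linarith)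
    simp [this]

lemma gaussianPDFReal_mul_sub {a b : ℝ} (ha : 0 < a) (hb : 0 < b) (x y : ℝ) :
    gaussianPDFReal 0 a.toNNReal (x - y) * gaussianPDFReal 0 b.toNNReal y =
      gaussianPDFReal 0 (a + b).toNNReal x *
        gaussianPDFReal (x * b / (a + b)) (a * b / (a + b)).toNNReal y := by
  have hab : 0 < a + b := by positivity
  have hq : 0 < a * b / (a + b) := by positivity
  simp only [gaussianPDFReal, Real.coe_toNNReal _ ha.le, Real.coe_toNNReal _ hb.le,
    Real.coe_toNNReal _ hab.le, Real.coe_toNNReal _ hq.le]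
  rw [mul_mul_mul_comm, mul_mul_mul_comm (√(2 * Real.pi * (a + b)))⁻¹, ← Real.exp_add,
    ← Real.exp_add, ← mul_inv, ← mul_inv, ← Real.sqrt_mul (by positivity),
    ← Real.sqrt_mul (by positivity)]
  have e1 : 2 * Real.pi * a * (2 * Real.pi * b) =
      2 * Real.pi * (a + b) * (2 * Real.pi * (a * b / (a + b))) := by field_simp
  have e2 : -(x - y - 0) ^ 2 / (2 * a) + -(y - 0) ^ 2 / (2 * b) =
      -(x - 0) ^ 2 / (2 * (a + b)) + -(y - x * b / (a + b)) ^ 2 / (2 * (a * b / (a + b))) := by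
    field_simp; ring
  rw [e1, e2]

lemma gaussianPDFReal_pow_three {t : ℝ} (ht : 0 < t) (x : ℝ) :
    gaussianPDFReal 0 (2 * t).toNNReal x ^ 3 =
      (4 * Real.pi * t)⁻¹ * (√3)⁻¹ * gaussianPDFReal 0 (2 * t / 3).toNNReal x := by
  have h1 : 0 < 2 * t := by positivity
  have h2 : 0 < 2 * t / 3 := by positivity
  simp only [gaussianPDFReal, Real.coe_toNNReal _ h1.le, Real.coe_toNNReal _ h2.le]
  rw [mul_pow, ← Real.exp_nat_mul]
  have e1 : 2 * Real.pi * (2 * t) = 4 * Real.pi * t := by ring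
  have e2 : 2 * Real.pi * (2 * t / 3) = (4 * Real.pi * t) / 3 := by ring
  rw [e1, e2]
  set s := 4 * Real.pi * t with hs
  have hs0 : 0 < s := by positivity
  have h3 : (√3)⁻¹ * (√(s / 3))⁻¹ = (√s)⁻¹ := by
    rw [← mul_inv, ← Real.sqrt_mul (by norm_num)]; congr 2; field_simp
  have h4 : (√s)⁻¹ ^ 3 = s⁻¹ * (√s)⁻¹ := by
    rw [pow_succ, inv_pow, Real.sq_sqrt hs0.le]
  rw [h4, mul_assoc s⁻¹ (√3)⁻¹, ← mul_assoc (√3)⁻¹, h3]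
  have h5 : ((3 : ℕ) : ℝ) * (-(x - 0) ^ 2 / (2 * (2 * t))) = -(x - 0) ^ 2 / (2 * (2 * t / 3)) := by
    push_cast; field_simp
  rw [h5]; ring

end Gaussian

section HeatKernel

open ProbabilityTheory NNReal

lemma heatP_nonneg (z : Fin 4 → ℝ) : 0 ≤ heatP z := by
  rw [heatP_eq_gaussProd]
  exact gaussProd_nonneg 0 _ _

lemma heatP_of_nonpos {z : Fin 4 → ℝ} (h : z 0 ≤ 0) : heatP z = 0 := if_neg h.not_gt

lemma measurable_heatP : Measurable heatP := by
  rw [show heatP = fun z : Fin 4 → ℝ => _ from funext heatP_eq_gaussProd]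
  have hv : Measurable fun z : Fin 4 → ℝ => (2 * z 0).toNNReal := by fun_prop
  have hx : Measurable fun (z : Fin 4 → ℝ) (i : Fin 3) => z i.succ := by fun_prop
  exact measurable_gaussProd hv (measurable_const (a := (0 : Fin 3 → ℝ))) hx

lemma integral_heatP_weight {w : ℝ → ℝ} (hw : Integrable w) (hpos : ∀ t, w t ≠ 0 → 0 < t) :
    Integrable (fun z : Fin 4 → ℝ => w (z 0) * heatP z) ∧
      ∫ z : Fin 4 → ℝ, w (z 0) * heatP z = ∫ t, w t := by
  have h := integral_time_weight (v := fun t => (2 * t).toNNReal) (m := fun _ _ => 0) (w := w)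
    (by fun_prop) measurable_const hw (fun t ht => by
      have := hpos t ht
      exact (Real.toNNReal_pos.2 (by positivity)).ne')
  simpa only [heatP_eq_gaussProd] using h

/-- The heat kernel restricted to times in `(0, 1)`. -/
noncomputable def heatP₁ (z : Fin 4 → ℝ) : ℝ := (Set.Ioo (0 : ℝ) 1).indicator 1 (z 0) * heatP z

/-- The space-time convolution of the heat kernel with itself. -/
noncomputable def heatQ (z : Fin 4 → ℝ) : ℝ := z 0 * heatP z

lemma heatQ_nonneg (z : Fin 4 → ℝ) : 0 ≤ heatQ z := by
  unfold heatQ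
  rcases le_or_gt (z 0) 0 with h | h
  · simp [heatP_of_nonpos h]
  · exact mul_nonneg h.le (heatP_nonneg z)

lemma measurable_heatQ : Measurable heatQ := (measurable_pi_apply 0).mul measurable_heatP

lemma integrable_indicator_Ioo (a b : ℝ) : Integrable ((Set.Ioo a b).indicator (1 : ℝ → ℝ)) :=
  (integrable_indicator_iff measurableSet_Ioo).2 (integrableOn_const (by simp))

lemma measurable_indicator_Ioo (a b : ℝ) : Measurable ((Set.Ioo a b).indicator (1 : ℝ → ℝ)) :=
  measurable_one.indicator measurableSet_Ioo

lemma heatP₁_nonneg (z : Fin 4 → ℝ) : 0 ≤ heatP₁ z :=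
  mul_nonneg (Set.indicator_nonneg (fun _ _ => zero_le_one) _) (heatP_nonneg z)

lemma heatP₁_le_heatP (z : Fin 4 → ℝ) : heatP₁ z ≤ heatP z := by
  unfold heatP₁
  refine mul_le_of_le_one_left (heatP_nonneg z) ?_
  exact Set.indicator_apply_le' (fun _ => le_rfl) (fun _ => zero_le_one)

lemma integrable_heatP₁ : Integrable heatP₁ := by
  refine (integral_heatP_weight (integrable_indicator_Ioo 0 1) fun t ht => ?_).1
  exact (Set.mem_of_indicator_ne_zero ht).1

lemma heatP_mul_sub {z w : Fin 4 → ℝ} (h0 : 0 < w 0) (h1 : w 0 < z 0) :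
    heatP (z - w) * heatP w = heatP z * ∏ i : Fin 3,
      gaussianPDFReal (z i.succ * (2 * w 0) / (2 * z 0))
        (2 * (z 0 - w 0) * (2 * w 0) / (2 * z 0)).toNNReal (w i.succ) := by
  simp only [heatP_eq_gaussProd, Pi.sub_apply]
  rw [← Finset.prod_mul_distrib, ← Finset.prod_mul_distrib]
  refine Finset.prod_congr rfl fun i _ => ?_
  have := gaussianPDFReal_mul_sub (a := 2 * (z 0 - w 0)) (b := 2 * w 0) (by linarith)
    (by linarith) (z i.succ) (w i.succ)
  rw [show 2 * (z 0 - w 0) + 2 * w 0 = 2 * z 0 by ring] at this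
  exact this

lemma heatP₁_conv (z : Fin 4 → ℝ) :
    stConv heatP₁ heatP₁ z = heatP z * ∫ s, (Set.Ioo (0 : ℝ) 1).indicator (1 : ℝ → ℝ) (z 0 - s) *
      (Set.Ioo (0 : ℝ) 1).indicator 1 s := by
  set w : ℝ → ℝ := fun s => (Set.Ioo (0 : ℝ) 1).indicator (1 : ℝ → ℝ) (z 0 - s) *
      (Set.Ioo (0 : ℝ) 1).indicator 1 s with hw
  have hwne : ∀ s, w s ≠ 0 → 0 < s ∧ s < z 0 := by
    intro s hs
    have h1 := Set.mem_of_indicator_ne_zero (left_ne_zero_of_mul hs)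
    have h2 := Set.mem_of_indicator_ne_zero (right_ne_zero_of_mul hs)
    exact ⟨h2.1, by linarith [h1.1]⟩
  have hwint : Integrable w := by
    refine (integrable_indicator_Ioo 0 1).bdd_mul (c := 1)
      ((measurable_indicator_Ioo 0 1).comp (measurable_const.sub measurable_id)).aestronglyMeasurable
      (Filter.Eventually.of_forall fun s => ?_)
    refine (norm_indicator_le_norm_self _ _).trans (by simp)
  have h := (integral_time_weight
    (v := fun s => (2 * (z 0 - s) * (2 * s) / (2 * z 0)).toNNReal)
    (m := fun s i => z i.succ * (2 * s) / (2 * z 0)) (w := w) (by fun_prop) (by fun_prop) hwint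
    (fun s hs => by
      obtain ⟨h1, h2⟩ := hwne s hs
      have h3 : 0 < z 0 - s := by linarith
      have h4 : 0 < z 0 := by linarith
      exact (Real.toNNReal_pos.2 (by positivity)).ne')).2
  rw [← h, ← integral_const_mul, stConv]
  congr 1 with y
  by_cases hy : w (y 0) = 0
  · rw [hy]
    simp only [hw] at hy
    simp only [heatP₁, Pi.sub_apply]
    linear_combination heatP (z - y) * heatP y * hy
  · obtain ⟨h1, h2⟩ := hwne _ hy
    have := heatP_mul_sub h1 h2
    simp only [heatP₁, Pi.sub_apply, hw]
    linear_combination ((Set.Ioo (0 : ℝ) 1).indicator (1 : ℝ → ℝ) (z 0 - y 0) *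
      (Set.Ioo (0 : ℝ) 1).indicator 1 (y 0)) * this

/-- Closed form of the heat kernel with square roots. -/
lemma heatP_eq {z : Fin 4 → ℝ} (h : 0 < z 0) : heatP z = (√(4 * Real.pi * z 0))⁻¹ ^ 3 *
    Real.exp (-((z 1) ^ 2 + (z 2) ^ 2 + (z 3) ^ 2) / (4 * z 0)) := by
  have hp : 0 < 4 * Real.pi * z 0 := by positivity
  have hr : (4 * Real.pi * z 0) ^ (-(3 : ℝ) / 2) = (√(4 * Real.pi * z 0))⁻¹ ^ 3 := by
    rw [Real.sqrt_eq_rpow, ← Real.rpow_neg hp.le, ← Real.rpow_natCast, ← Real.rpow_mul hp.le]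
    norm_num
  rw [heatP, if_pos h, hr]

lemma heatP_le_exp {z : Fin 4 → ℝ} (h : 0 < z 0) : heatP z ≤ (√(z 0))⁻¹ ^ 3 *
    Real.exp (-((z 1) ^ 2 + (z 2) ^ 2 + (z 3) ^ 2) / (4 * z 0)) := by
  rw [heatP_eq h]
  have := Real.pi_gt_three
  gcongr
  nlinarith

lemma heatP_le {z : Fin 4 → ℝ} (h : 0 < z 0) : heatP z ≤ (√(z 0))⁻¹ ^ 3 := by
  refine (heatP_le_exp h).trans (mul_le_of_le_one_right (by positivity) (Real.exp_le_one_iff.2 ?_))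
  rw [neg_div]
  exact neg_nonpos.2 (by positivity)

lemma heatQ_le {z : Fin 4 → ℝ} (h : 0 < z 0) : heatQ z ≤ (√(z 0))⁻¹ := by
  have h1 := mul_le_mul_of_nonneg_left (heatP_le h) h.le
  have h2 : z 0 * (√(z 0))⁻¹ ^ 3 = (√(z 0))⁻¹ := by
    have h3 : 0 < √(z 0) := Real.sqrt_pos.2 h
    nth_rewrite 1 [← Real.sq_sqrt h.le]
    field_simp
  exact h1.trans h2.le

lemma abs_heatP₁_conv_sub_heatQ_le (z : Fin 4 → ℝ) :
    |stConv heatP₁ heatP₁ z - heatQ z| ≤ 1 := by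
  rw [heatP₁_conv]
  set w : ℝ → ℝ := fun s => (Set.Ioo (0 : ℝ) 1).indicator (1 : ℝ → ℝ) (z 0 - s) *
      (Set.Ioo (0 : ℝ) 1).indicator 1 s with hw
  rcases le_or_gt (z 0) 0 with h | h
  · simp [heatQ, heatP_of_nonpos h]
  have hI : ∫ s, (Set.Ioo (0 : ℝ) (z 0)).indicator (1 : ℝ → ℝ) s = z 0 := by
    rw [integral_indicator_one measurableSet_Ioo]; simp [h.le]
  rcases le_or_gt (z 0) 1 with h1 | h1
  · have : w = (Set.Ioo (0 : ℝ) (z 0)).indicator (1 : ℝ → ℝ) := by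
      funext s
      simp only [hw, Set.indicator, Set.mem_Ioo, Pi.one_apply]
      split_ifs <;> first | (norm_num; done) | grind
    rw [this, hI, heatQ, mul_comm, sub_self]
    simp
  · have h0 : 0 ≤ ∫ s, w s := integral_nonneg fun s =>
      mul_nonneg (Set.indicator_nonneg (fun _ _ => zero_le_one) _)
        (Set.indicator_nonneg (fun _ _ => zero_le_one) _)
    have h2 : ∫ s, w s ≤ z 0 := by
      rw [← hI]
      refine integral_mono_of_nonneg (Filter.Eventually.of_forall fun s =>
        mul_nonneg (Set.indicator_nonneg (fun _ _ => zero_le_one) _)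
          (Set.indicator_nonneg (fun _ _ => zero_le_one) _)) (integrable_indicator_Ioo _ _)
        (Filter.Eventually.of_forall fun s => ?_)
      simp only [hw, Set.indicator, Set.mem_Ioo, Pi.one_apply]
      split_ifs <;> first | (norm_num; done) | grind
    have hP := heatP_nonneg z
    have hQ : heatQ z ≤ 1 := (heatQ_le h).trans
      (inv_le_one_of_one_le₀ (Real.one_le_sqrt.2 h1.le))
    have h3 : heatP z * ∫ s, w s ≤ heatQ z := by
      unfold heatQ; nlinarith
    have h4 : 0 ≤ heatP z * ∫ s, w s := by positivity
    rw [abs_le]; constructor <;> linarith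

lemma heatP_bounded_off_ball {δ : ℝ} (hδ : 0 < δ) :
    ∃ C, 1 ≤ C ∧ ∀ z : Fin 4 → ℝ, δ ≤ ‖z‖ → heatP z ≤ C := by
  refine ⟨1 + (√δ)⁻¹ ^ 3 + 32 / δ ^ 4, by
    have : 0 ≤ (√δ)⁻¹ ^ 3 + 32 / δ ^ 4 := by positivity
    linarith, fun z hz => ?_⟩
  have hA : 0 ≤ (√δ)⁻¹ ^ 3 := by positivity
  have hB : 0 ≤ 32 / δ ^ 4 := by positivity
  rcases le_or_gt (z 0) 0 with h | h
  · rw [heatP_of_nonpos h]; linarith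
  rcases le_or_gt 1 (z 0) with h1 | h1
  · have : heatP z ≤ 1 := (heatP_le h).trans
      (pow_le_one₀ (by positivity) (inv_le_one_of_one_le₀ (Real.one_le_sqrt.2 h1)))
    linarith
  rcases le_or_gt δ (z 0) with h2 | h2
  · have : heatP z ≤ (√δ)⁻¹ ^ 3 := (heatP_le h).trans (by gcongr)
    linarith
  have hx : δ ^ 2 ≤ z 1 ^ 2 + z 2 ^ 2 + z 3 ^ 2 := by
    by_contra! hlt
    have hz' : ‖z‖ < δ := by
      rw [pi_norm_lt_iff hδ]
      intro i
      rw [Real.norm_eq_abs]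
      fin_cases i
      · simpa [abs_of_pos h] using h2
      all_goals
        refine abs_lt_of_sq_lt_sq ?_ hδ.le
        simp only [Fin.mk_one, Fin.reduceFinMk]
        nlinarith [sq_nonneg (z 1), sq_nonneg (z 2), sq_nonneg (z 3)]
    linarith
  set y := δ ^ 2 / (4 * z 0) with hy
  have hy0 : 0 < y := by positivity
  have he : Real.exp (-((z 1) ^ 2 + (z 2) ^ 2 + (z 3) ^ 2) / (4 * z 0)) ≤ 2 / y ^ 2 := by
    have h3 : y ^ 2 / 2 ≤ Real.exp y := by
      have := Real.quadratic_le_exp_of_nonneg hy0.le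
      nlinarith
    have h4 : Real.exp (-((z 1) ^ 2 + (z 2) ^ 2 + (z 3) ^ 2) / (4 * z 0)) ≤ Real.exp (-y) := by
      rw [Real.exp_le_exp, hy, neg_div, neg_le_neg_iff]
      gcongr
    refine h4.trans ?_
    rw [Real.exp_neg, inv_le_comm₀ (Real.exp_pos _) (by positivity), inv_div]
    exact h3
  have h5 := (heatP_le_exp h).trans (mul_le_mul_of_nonneg_left he (by positivity))
  have hs0 : 0 < √(z 0) := Real.sqrt_pos.2 h
  have hs1 : √(z 0) ≤ 1 := Real.sqrt_le_one.2 h1.le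
  have h6 : (√(z 0))⁻¹ ^ 3 * (2 / y ^ 2) = √(z 0) * (32 / δ ^ 4) := by
    rw [hy]
    have : z 0 = √(z 0) ^ 2 := (Real.sq_sqrt h.le).symm
    generalize √(z 0) = r at *
    rw [this]
    field_simp
    ring
  rw [h6] at h5
  nlinarith

lemma heatQ_bounded_off_ball {δ : ℝ} (hδ : 0 < δ) :
    ∃ C, 1 ≤ C ∧ ∀ z : Fin 4 → ℝ, δ ≤ ‖z‖ → heatQ z ≤ C := by
  obtain ⟨C, hC, h⟩ := heatP_bounded_off_ball hδ
  refine ⟨C, hC, fun z hz => ?_⟩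
  rcases le_or_gt (z 0) 1 with h1 | h1
  · exact (mul_le_of_le_one_left (heatP_nonneg z) h1).trans (h z hz)
  · exact ((heatQ_le (by linarith)).trans
      (inv_le_one_of_one_le₀ (Real.one_le_sqrt.2 h1.le))).trans hC

end HeatKernel

section Increments

lemma abs_exp_neg_sq_sub_le {s : ℝ} (hs : 0 < s) (x y : ℝ) :
    |Real.exp (-x ^ 2 / (4 * s)) - Real.exp (-y ^ 2 / (4 * s))| ≤ |x - y| / √s := by
  have hd : ∀ u : ℝ, HasDerivAt (fun u : ℝ => Real.exp (-u ^ 2 / (4 * s)))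
      (Real.exp (-u ^ 2 / (4 * s)) * (-(2 * u) / (4 * s))) u := by
    intro u
    have h1 : HasDerivAt (fun u : ℝ => -u ^ 2 / (4 * s)) (-(2 * u) / (4 * s)) u := by
      simpa using ((hasDerivAt_pow 2 u).neg).div_const (4 * s)
    exact h1.exp
  have hb : ∀ u ∈ (Set.univ : Set ℝ),
      ‖Real.exp (-u ^ 2 / (4 * s)) * (-(2 * u) / (4 * s))‖ ≤ 1 / √s := by
    intro u _
    have hr : 0 < √s := Real.sqrt_pos.2 hs
    have hsr : s = √s ^ 2 := (Real.sq_sqrt hs.le).symm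
    generalize √s = r at hr hsr
    subst hsr
    set v := |u| / (2 * r) with hv
    have hv0 : 0 ≤ v := by positivity
    have e1 : -u ^ 2 / (4 * r ^ 2) = -(v ^ 2) := by
      rw [hv, div_pow, sq_abs]; field_simp; ring
    have e2 : ‖-(2 * u) / (4 * r ^ 2)‖ = v / r := by
      rw [Real.norm_eq_abs, abs_div, abs_neg, abs_mul, abs_two,
        abs_of_pos (by positivity : 0 < 4 * r ^ 2), hv]
      field_simp; ring
    rw [norm_mul, e2, e1, Real.norm_of_nonneg (Real.exp_pos _).le, Real.exp_neg, mul_div_assoc']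
    gcongr
    rw [inv_mul_le_iff₀ (Real.exp_pos _), mul_one]
    nlinarith [Real.add_one_le_exp (v ^ 2)]
  have := convex_univ.norm_image_sub_le_of_norm_hasDerivWithin_le
    (fun u _ => (hd u).hasDerivWithinAt) hb (Set.mem_univ y) (Set.mem_univ x)
  rw [Real.norm_eq_abs, Real.norm_eq_abs] at this
  rwa [one_div_mul_eq_div] at this

lemma abs_inv_sqrt_mul_exp_sub_le {t s a : ℝ} (ht : 0 < t) (ha : 0 ≤ a) (hst : |t - s| ≤ t / 2) :
    |(√s)⁻¹ * Real.exp (-a / s) - (√t)⁻¹ * Real.exp (-a / t)| ≤ 12 * |t - s| / (t * √t) := by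
  have hd : ∀ u : ℝ, 0 < u → HasDerivAt (fun u : ℝ => (√u)⁻¹ * Real.exp (-a / u))
      (-(1 / (2 * √u)) / √u ^ 2 * Real.exp (-a / u) +
        (√u)⁻¹ * (Real.exp (-a / u) * (a / u ^ 2))) u := by
    intro u hu
    have h1 := (Real.hasDerivAt_sqrt hu.ne').inv (Real.sqrt_pos.2 hu).ne'
    have h2 : HasDerivAt (fun u : ℝ => -a / u) (a / u ^ 2) u := by
      have := (hasDerivAt_inv hu.ne').const_mul (-a)
      convert! this using 1
      field_simp
    exact h1.mul h2.exp
  have hb : ∀ u ∈ Set.Icc (t / 2) (3 * t / 2),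
      ‖-(1 / (2 * √u)) / √u ^ 2 * Real.exp (-a / u) +
        (√u)⁻¹ * (Real.exp (-a / u) * (a / u ^ 2))‖ ≤ 12 / (t * √t) := by
    intro u hu
    have hu0 : 0 < u := by linarith [hu.1]
    have hr : 0 < √u := Real.sqrt_pos.2 hu0
    have hur : u = √u ^ 2 := (Real.sq_sqrt hu0.le).symm
    have hq : √t / 2 ≤ √u := by
      rw [div_le_iff₀ two_pos]
      refine Real.sqrt_le_iff.2 ⟨by positivity, ?_⟩
      rw [mul_pow, ← hur]; linarith [hu.1]
    have hE : Real.exp (-a / u) * (a / u) ≤ 1 := by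
      rw [neg_div, Real.exp_neg, inv_mul_le_iff₀ (Real.exp_pos _), mul_one]
      linarith [Real.add_one_le_exp (a / u)]
    have hE1 : Real.exp (-a / u) ≤ 1 := Real.exp_le_one_iff.2 (by
      rw [neg_div]; exact neg_nonpos.2 (by positivity))
    have hE0 := Real.exp_pos (-a / u)
    have e1 : -(1 / (2 * √u)) / √u ^ 2 * Real.exp (-a / u) +
        (√u)⁻¹ * (Real.exp (-a / u) * (a / u ^ 2)) =
        (Real.exp (-a / u) * (a / u) - Real.exp (-a / u) / 2) * (1 / (u * √u)) := by
      rw [← hur]; field_simp; ring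
    have hau : 0 ≤ Real.exp (-a / u) * (a / u) := by positivity
    have e2 : |Real.exp (-a / u) * (a / u) - Real.exp (-a / u) / 2| ≤ 1 := by
      rw [abs_le]; constructor <;> linarith
    rw [e1, norm_mul, Real.norm_eq_abs, Real.norm_of_nonneg (by positivity)]
    have hst0 : 0 < √t := Real.sqrt_pos.2 ht
    have e3 : 1 / (u * √u) ≤ 12 / (t * √t) := by
      rw [div_le_div_iff₀ (by positivity) (by positivity)]
      have : (t / 2) * (√t / 2) ≤ u * √u := by gcongr; exact hu.1
      linarith [mul_pos ht hst0]
    calc _ ≤ 1 * (1 / (u * √u)) := by gcongr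
      _ ≤ _ := by rwa [one_mul]
  have := (convex_Icc (t / 2) (3 * t / 2)).norm_image_sub_le_of_norm_hasDerivWithin_le
    (fun u hu => (hd u (by linarith [hu.1])).hasDerivWithinAt) hb
    (x := t) (y := s) ⟨by linarith, by linarith⟩
    ⟨by linarith [(abs_le.1 hst).2], by linarith [(abs_le.1 hst).1]⟩
  rw [Real.norm_eq_abs, Real.norm_eq_abs, abs_sub_comm s t] at this
  rwa [mul_div_right_comm]

lemma heatQ_eq {z : Fin 4 → ℝ} (h : 0 < z 0) : heatQ z = (√(4 * Real.pi))⁻¹ ^ 3 *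
    ((√(z 0))⁻¹ * Real.exp (-((z 1) ^ 2 + (z 2) ^ 2 + (z 3) ^ 2) / (4 * z 0))) := by
  rw [heatQ, heatP_eq h, Real.sqrt_mul (by positivity), mul_inv, mul_pow]
  have hr : 0 < √(z 0) := Real.sqrt_pos.2 h
  have hsr : z 0 = √(z 0) ^ 2 := (Real.sq_sqrt h.le).symm
  nth_rewrite 1 [hsr]
  field_simp

lemma abs_exp_sum_sq_sub_le {s : ℝ} (hs : 0 < s) (z w : Fin 4 → ℝ) :
    |Real.exp (-((w 1) ^ 2 + (w 2) ^ 2 + (w 3) ^ 2) / (4 * s)) -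
      Real.exp (-((z 1) ^ 2 + (z 2) ^ 2 + (z 3) ^ 2) / (4 * s))| ≤
      (|w 1 - z 1| + |w 2 - z 2| + |w 3 - z 3|) / √s := by
  have hsplit : ∀ v : Fin 4 → ℝ, Real.exp (-((v 1) ^ 2 + (v 2) ^ 2 + (v 3) ^ 2) / (4 * s)) =
      Real.exp (-v 1 ^ 2 / (4 * s)) * Real.exp (-v 2 ^ 2 / (4 * s)) *
        Real.exp (-v 3 ^ 2 / (4 * s)) := by
    intro v
    rw [← Real.exp_add, ← Real.exp_add]
    congr 1; ring
  have hle : ∀ u : ℝ, |Real.exp (-u ^ 2 / (4 * s))| ≤ 1 := fun u => by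
    rw [abs_of_pos (Real.exp_pos _), Real.exp_le_one_iff, neg_div]
    exact neg_nonpos.2 (by positivity)
  rw [hsplit, hsplit]
  have h1 := abs_exp_neg_sq_sub_le hs (w 1) (z 1)
  have h2 := abs_exp_neg_sq_sub_le hs (w 2) (z 2)
  have h3 := abs_exp_neg_sq_sub_le hs (w 3) (z 3)
  have b1 := hle (z 1)
  have b2 := hle (z 2)
  have b2' := hle (w 2)
  have b3' := hle (w 3)
  generalize Real.exp (-w 1 ^ 2 / (4 * s)) = a1 at *
  generalize Real.exp (-w 2 ^ 2 / (4 * s)) = a2 at *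
  generalize Real.exp (-w 3 ^ 2 / (4 * s)) = a3 at *
  generalize Real.exp (-z 1 ^ 2 / (4 * s)) = c1 at *
  generalize Real.exp (-z 2 ^ 2 / (4 * s)) = c2 at *
  generalize Real.exp (-z 3 ^ 2 / (4 * s)) = c3 at *
  have e : a1 * a2 * a3 - c1 * c2 * c3 =
      (a1 - c1) * (a2 * a3) + (c1 * a3) * (a2 - c2) + (c1 * c2) * (a3 - c3) := by ring
  rw [e, add_div, add_div]
  refine (abs_add_le _ _).trans (add_le_add ((abs_add_le _ _).trans (add_le_add ?_ ?_)) ?_)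
  · rw [abs_mul, abs_mul]
    exact (mul_le_of_le_one_right (abs_nonneg _)
      (mul_le_one₀ b2' (abs_nonneg _) b3')).trans h1
  · rw [abs_mul, abs_mul]
    exact (mul_le_of_le_one_left (abs_nonneg _)
      (mul_le_one₀ b1 (abs_nonneg _) b3')).trans h2
  · rw [abs_mul, abs_mul]
    exact (mul_le_of_le_one_left (abs_nonneg _)
      (mul_le_one₀ b1 (abs_nonneg _) b2)).trans h3

lemma abs_heatQ_sub_le {z w : Fin 4 → ℝ} (hz : 0 < z 0) (hw : |z 0 - w 0| ≤ z 0 / 2) :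
    |heatQ w - heatQ z| ≤ 12 * |z 0 - w 0| / (z 0 * √(z 0)) +
      2 * (|w 1 - z 1| + |w 2 - z 2| + |w 3 - z 3|) / z 0 := by
  have hw0 : z 0 / 2 ≤ w 0 := by linarith [(abs_le.1 hw).2]
  have hwp : 0 < w 0 := by linarith
  rw [heatQ_eq hz, heatQ_eq hwp, ← mul_sub, abs_mul]
  have hk : |(√(4 * Real.pi))⁻¹ ^ 3| ≤ 1 := by
    rw [abs_of_nonneg (by positivity)]
    refine pow_le_one₀ (by positivity) (inv_le_one_of_one_le₀ (Real.one_le_sqrt.2 ?_))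
    linarith [Real.pi_gt_three]
  refine (mul_le_of_le_one_left (abs_nonneg _) hk).trans ?_
  have h1 := abs_exp_sum_sq_sub_le hwp z w
  have h2 := abs_inv_sqrt_mul_exp_sub_le (a := ((z 1) ^ 2 + (z 2) ^ 2 + (z 3) ^ 2) / 4) hz
    (by positivity) hw
  have e : ∀ s : ℝ, -(((z 1) ^ 2 + (z 2) ^ 2 + (z 3) ^ 2) / 4) / s =
      -((z 1) ^ 2 + (z 2) ^ 2 + (z 3) ^ 2) / (4 * s) := fun s => by
    rw [← neg_div, div_div]
  rw [e, e] at h2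
  have h3 : |(√(w 0))⁻¹ * Real.exp (-((w 1) ^ 2 + (w 2) ^ 2 + (w 3) ^ 2) / (4 * w 0)) -
      (√(w 0))⁻¹ * Real.exp (-((z 1) ^ 2 + (z 2) ^ 2 + (z 3) ^ 2) / (4 * w 0))| ≤
      2 * (|w 1 - z 1| + |w 2 - z 2| + |w 3 - z 3|) / z 0 := by
    rw [← mul_sub, abs_mul, abs_of_nonneg (by positivity : 0 ≤ (√(w 0))⁻¹)]
    refine (mul_le_mul_of_nonneg_left h1 (by positivity)).trans ?_
    rw [← div_eq_inv_mul, div_div, Real.mul_self_sqrt hwp.le, div_le_div_iff₀ hwp hz]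
    have : 0 ≤ |w 1 - z 1| + |w 2 - z 2| + |w 3 - z 3| := by positivity
    nlinarith
  have h4 := abs_add_le
    ((√(w 0))⁻¹ * Real.exp (-((w 1) ^ 2 + (w 2) ^ 2 + (w 3) ^ 2) / (4 * w 0)) -
      (√(w 0))⁻¹ * Real.exp (-((z 1) ^ 2 + (z 2) ^ 2 + (z 3) ^ 2) / (4 * w 0)))
    ((√(w 0))⁻¹ * Real.exp (-((z 1) ^ 2 + (z 2) ^ 2 + (z 3) ^ 2) / (4 * w 0)) -
      (√(z 0))⁻¹ * Real.exp (-((z 1) ^ 2 + (z 2) ^ 2 + (z 3) ^ 2) / (4 * z 0)))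
  rw [sub_add_sub_cancel] at h4
  linarith

end Increments

section Logarithm

open ProbabilityTheory

/-- The prefactor of the logarithm in the truncated integral of `heatP * heatQ ^ 2`. -/
noncomputable def logConst : ℝ := ((4 * Real.pi)⁻¹ * (√3)⁻¹) ^ 3

lemma logConst_pos : 0 < logConst := by
  unfold logConst; positivity

lemma heatP_mul_heatQ_sq {z : Fin 4 → ℝ} (h : 0 < z 0) :
    heatP z * heatQ z ^ 2 = logConst / z 0 *
      ∏ i : Fin 3, gaussianPDFReal 0 (2 * z 0 / 3).toNNReal (z i.succ) := by
  have e : heatP z ^ 3 = ((4 * Real.pi * z 0)⁻¹ * (√3)⁻¹) ^ 3 *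
      ∏ i : Fin 3, gaussianPDFReal 0 (2 * z 0 / 3).toNNReal (z i.succ) := by
    rw [heatP_eq_gaussProd, ← Finset.prod_pow]
    simp only [gaussianPDFReal_pow_three h, Finset.prod_mul_distrib, Finset.prod_const,
      Finset.card_univ, Fintype.card_fin]
    ring
  have e2 : heatP z * heatQ z ^ 2 = z 0 ^ 2 * heatP z ^ 3 := by unfold heatQ; ring
  rw [e2, e, logConst]
  field_simp

/-- The logarithmic divergence of the heat kernel integral truncated to times in `[T, 1)`. -/
lemma integral_heatP_heatQ_sq {T : ℝ} (hT : 0 < T) :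
    Integrable (fun z : Fin 4 → ℝ =>
      (Set.Ico T 1).indicator (1 : ℝ → ℝ) (z 0) * (heatP z * heatQ z ^ 2)) ∧
    ∫ z : Fin 4 → ℝ, (Set.Ico T 1).indicator (1 : ℝ → ℝ) (z 0) * (heatP z * heatQ z ^ 2) =
      logConst * max 0 (Real.log (1 / T)) := by
  have hw : Integrable ((Set.Ico T 1).indicator fun t : ℝ => logConst / t) := by
    rw [integrable_indicator_iff measurableSet_Ico]
    refine IntegrableOn.mono_set ?_ Set.Ico_subset_Icc_self
    refine ContinuousOn.integrableOn_compact isCompact_Icc ?_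
    exact continuousOn_const.div continuousOn_id fun t ht => (hT.trans_le ht.1).ne'
  have h := integral_time_weight (v := fun t => (2 * t / 3).toNNReal) (m := fun _ _ => 0)
    (by fun_prop) measurable_const hw (fun t ht => by
      have : 0 < t := hT.trans_le (Set.mem_of_indicator_ne_zero ht).1
      exact (Real.toNNReal_pos.2 (by positivity)).ne')
  have e : ∀ z : Fin 4 → ℝ,
      (Set.Ico T 1).indicator (1 : ℝ → ℝ) (z 0) * (heatP z * heatQ z ^ 2) =
      (Set.Ico T 1).indicator (fun t : ℝ => logConst / t) (z 0) *
        ∏ i : Fin 3, gaussianPDFReal 0 (2 * z 0 / 3).toNNReal (z i.succ) := by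
    intro z
    by_cases hz : z 0 ∈ Set.Ico T 1
    · rw [Set.indicator_of_mem hz, Set.indicator_of_mem hz, Pi.one_apply, one_mul,
        heatP_mul_heatQ_sq (hT.trans_le hz.1)]
    · rw [Set.indicator_of_notMem hz, Set.indicator_of_notMem hz, zero_mul, zero_mul]
  simp only [e]
  refine ⟨h.1, h.2.trans ?_⟩
  rw [integral_indicator measurableSet_Ico]
  rcases le_or_gt 1 T with h1 | h1
  · rw [Set.Ico_eq_empty (by simpa using h1), max_eq_left]
    · simp
    · exact Real.log_nonpos (by positivity) ((div_le_one hT).2 h1)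
  · rw [integral_Ico_eq_integral_Ioo, ← integral_Ioc_eq_integral_Ioo,
      ← intervalIntegral.integral_of_le h1.le, max_eq_right]
    · simp only [div_eq_mul_inv]
      rw [intervalIntegral.integral_const_mul, integral_inv_of_pos hT one_pos]
      simp
    · exact Real.log_nonneg ((one_le_div hT).2 h1.le)

end Logarithm

section Mollifier

/-- Quantitative description of a mollifier at parabolic scale `ε`. -/
structure IsParabolicMollifier (A M ε : ℝ) (η : (Fin 4 → ℝ) → ℝ) : Prop where
  continuous : Continuous η
  hasCompactSupport : HasCompactSupport η
  integral_eq_one : ∫ w, η w = 1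
  integral_abs_le : ∫ w, |η w| ≤ A
  abs_le : ∀ w, |η w| ≤ A * (ε ^ 5)⁻¹
  abs_time_le : ∀ w, η w ≠ 0 → |w 0| ≤ M * ε ^ 2
  abs_space_le : ∀ w, η w ≠ 0 → ∀ i, i ≠ 0 → |w i| ≤ M * ε

lemma IsParabolicMollifier.integrable {A M ε : ℝ} {η : (Fin 4 → ℝ) → ℝ}
    (h : IsParabolicMollifier A M ε η) : Integrable η :=
  h.continuous.integrable_of_hasCompactSupport h.hasCompactSupport

lemma IsParabolicMollifier.nonneg {A M ε : ℝ} {η : (Fin 4 → ℝ) → ℝ}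
    (h : IsParabolicMollifier A M ε η) : 0 ≤ A :=
  (integral_nonneg fun _ => abs_nonneg _).trans h.integral_abs_le

lemma stConv_eq_convolution (f g : (Fin 4 → ℝ) → ℝ) :
    stConv f g = convolution f g (ContinuousLinearMap.mul ℝ ℝ) volume := by
  funext z
  rw [convolution_mul_swap, stConv]

lemma stConv_comm (f g : (Fin 4 → ℝ) → ℝ) : stConv f g = stConv g f := by
  funext z
  rw [stConv, stConv, ← integral_sub_left_eq_self _ volume z]
  simp only [sub_sub_cancel, mul_comm]

lemma integrable_stConv {f g : (Fin 4 → ℝ) → ℝ} (hf : Integrable f) (hg : Integrable g) :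
    Integrable (stConv f g) := by
  rw [stConv_eq_convolution]
  exact hf.integrable_convolution _ hg

lemma integral_stConv {f g : (Fin 4 → ℝ) → ℝ} (hf : Integrable f) (hg : Integrable g) :
    ∫ z, stConv f g z = (∫ z, f z) * ∫ z, g z := by
  rw [stConv_eq_convolution, integral_convolution _ hf hg]
  simp

lemma abs_stConv_le_of_bounded {f g : (Fin 4 → ℝ) → ℝ} {B : ℝ} (hf : Integrable f)
    (hg : ∀ w, |g w| ≤ B) (z : Fin 4 → ℝ) : |stConv f g z| ≤ B * ∫ w, |f w| := by
  rw [stConv, ← Real.norm_eq_abs, ← integral_sub_left_eq_self (fun w => |f w|) volume z,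
    ← integral_const_mul]
  refine norm_integral_le_of_norm_le ((hf.abs.comp_sub_left z).const_mul B)
    (Filter.Eventually.of_forall fun w => ?_)
  rw [norm_mul, mul_comm]
  exact mul_le_mul_of_nonneg_right (hg w) (abs_nonneg _)

lemma integrable_mul_of_bounded {f g : (Fin 4 → ℝ) → ℝ} {B : ℝ} (hf : Integrable f)
    (hgm : AEStronglyMeasurable g) (hg : ∀ w, |g w| ≤ B) (z : Fin 4 → ℝ) :
    Integrable fun w => f (z - w) * g w :=
  (hf.comp_sub_left z).mul_bdd hgm (Filter.Eventually.of_forall hg)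

lemma stConv_assoc {f g k : (Fin 4 → ℝ) → ℝ} {B : ℝ} (hf : Integrable f) (hg : Integrable g)
    (hk : Integrable k) (hB : ∀ w, |k w| ≤ B) :
    stConv (stConv f g) k = stConv f (stConv g k) := by
  funext z
  simp only [stConv_eq_convolution]
  refine convolution_assoc _ _ _ _ (fun x y w => by simp [mul_assoc])
    hf.aestronglyMeasurable hg.aestronglyMeasurable hk.aestronglyMeasurable
    (hf.ae_convolution_exists _ hg) (hg.norm.ae_convolution_exists _ hk.norm) ?_
  have h1 := integrable_stConv hg.norm hk.norm
  have h2 : ∀ w, |stConv (fun x => ‖g x‖) (fun x => ‖k x‖) w| ≤ B * ∫ w, |‖g w‖| :=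
    abs_stConv_le_of_bounded hg.norm (by simpa using hB)
  have h3 := integrable_mul_of_bounded hf.norm h1.aestronglyMeasurable h2 z
  rw [stConv_eq_convolution] at h3
  rw [ConvolutionExistsAt, ← integrable_comp_sub_left _ z]
  simpa only [sub_sub_cancel, ContinuousLinearMap.mul_apply'] using h3

lemma IsParabolicMollifier.stConv {A M ε : ℝ} {f g : (Fin 4 → ℝ) → ℝ}
    (hf : IsParabolicMollifier A M ε f) (hg : IsParabolicMollifier A M ε g) :
    IsParabolicMollifier (A * A) (2 * M) ε (stConv f g) := by
  have hA := hf.nonneg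
  have hsupp : ∀ z, _root_.stConv f g z ≠ 0 → ∃ w, f (z - w) ≠ 0 ∧ g w ≠ 0 := by
    intro z hz
    by_contra! h
    refine hz ?_
    rw [_root_.stConv]
    refine integral_eq_zero_of_ae (Filter.Eventually.of_forall fun w => ?_)
    by_cases hw : f (z - w) = 0
    · simp [hw]
    · simp [h w hw]
  refine ⟨?_, ?_, ?_, ?_, ?_, ?_, ?_⟩
  · rw [stConv_eq_convolution]
    exact hg.hasCompactSupport.continuous_convolution_right _ hf.continuous.locallyIntegrable
      hg.continuous
  · rw [stConv_eq_convolution]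
    exact hf.hasCompactSupport.convolution _ hg.hasCompactSupport
  · rw [integral_stConv hf.integrable hg.integrable, hf.integral_eq_one, hg.integral_eq_one,
      one_mul]
  · have h1 : ∫ w, |_root_.stConv f g w| ≤
        ∫ w, _root_.stConv (fun x => |f x|) (fun x => |g x|) w := by
      refine integral_mono (integrable_stConv hf.integrable hg.integrable).abs
        (integrable_stConv hf.integrable.abs hg.integrable.abs) fun w => ?_
      have h2 := norm_integral_le_integral_norm (μ := volume) fun v => f (w - v) * g v
      simpa only [norm_mul, Real.norm_eq_abs, _root_.stConv] using h2
    rw [integral_stConv hf.integrable.abs hg.integrable.abs] at h1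
    refine h1.trans ?_
    exact mul_le_mul hf.integral_abs_le hg.integral_abs_le
      (integral_nonneg fun _ => abs_nonneg _) hA
  · intro w
    refine (abs_stConv_le_of_bounded hf.integrable hg.abs_le w).trans ?_
    have h0 : 0 ≤ A * (ε ^ 5)⁻¹ := (abs_nonneg _).trans (hg.abs_le w)
    calc _ ≤ A * (ε ^ 5)⁻¹ * A := by gcongr; exact hf.integral_abs_le
      _ = _ := by ring
  · intro z hz
    obtain ⟨w, h1, h2⟩ := hsupp z hz
    have h3 := hf.abs_time_le _ h1
    have h4 := hg.abs_time_le _ h2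
    have h5 := abs_add_le (z 0 - w 0) (w 0)
    rw [sub_add_cancel] at h5
    rw [Pi.sub_apply] at h3
    linarith
  · intro z hz i hi
    obtain ⟨w, h1, h2⟩ := hsupp z hz
    have h3 := hf.abs_space_le _ h1 i hi
    have h4 := hg.abs_space_le _ h2 i hi
    have h5 := abs_add_le (z i - w i) (w i)
    rw [sub_add_cancel] at h5
    rw [Pi.sub_apply] at h3
    linarith

lemma integral_comp_parabolic_dilation {f : (Fin 4 → ℝ) → ℝ} (hf : Continuous f) {ε : ℝ}
    (hε : 0 < ε) :
    ∫ z : Fin 4 → ℝ, f (fun i => if i = 0 then z 0 / ε ^ 2 else z i / ε) = ε ^ 5 * ∫ z, f z := by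
  set d : Fin 4 → ℝ := fun i => if i = 0 then (ε ^ 2)⁻¹ else ε⁻¹ with hd
  have hdet : (Matrix.diagonal d).det = (ε ^ 5)⁻¹ := by
    rw [Matrix.det_diagonal, Fin.prod_univ_four]
    simp [hd]
    field_simp
  have hdet0 : (Matrix.diagonal d).det ≠ 0 := by rw [hdet]; positivity
  have hmap := Real.map_matrix_volume_pi_eq_smul_volume_pi hdet0
  have hfun : ∀ z : Fin 4 → ℝ, (fun i => if i = 0 then z 0 / ε ^ 2 else z i / ε) =
      Matrix.toLin' (Matrix.diagonal d) z := by
    intro z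
    funext i
    rw [Matrix.toLin'_apply, Matrix.mulVec_diagonal]
    simp only [hd]
    split_ifs with h
    · rw [h]; ring
    · ring
  simp only [hfun]
  rw [← integral_map (LinearMap.continuous_on_pi _).aemeasurable hf.aestronglyMeasurable, hmap,
    integral_smul_measure, hdet, inv_inv, abs_of_pos (by positivity),
    ENNReal.toReal_ofReal (by positivity), smul_eq_mul]

lemma exists_isParabolicMollifier {ρ : (Fin 4 → ℝ) → ℝ} (hc : Continuous ρ)
    (hs : HasCompactSupport ρ) (hi : ∫ z, ρ z = 1) :
    ∃ A M : ℝ, 1 ≤ M ∧ ∀ ε : ℝ, 0 < ε → IsParabolicMollifier A M ε (parRescale ε ρ) := by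
  obtain ⟨B, hB⟩ := hc.bounded_above_of_compact_support hs
  obtain ⟨M, hM⟩ := hs.isCompact.isBounded.exists_norm_le
  have hMρ : ∀ w, ρ w ≠ 0 → ∀ i, |w i| ≤ max M 1 := fun w hw i =>
    (norm_le_pi_norm w i).trans ((hM w (subset_tsupport _ hw)).trans (le_max_left _ _))
  refine ⟨max B (∫ w, |ρ w|), max M 1, le_max_right _ _, fun ε hε => ?_⟩
  have h5 : ε ^ 5 ≠ 0 := by positivity
  have hφ : Continuous fun (z : Fin 4 → ℝ) (i : Fin 4) =>
      if i = 0 then z 0 / ε ^ 2 else z i / ε := by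
    refine continuous_pi fun i => ?_
    split_ifs <;> fun_prop
  refine ⟨?_, ?_, ?_, ?_, ?_, ?_, ?_⟩
  · exact continuous_const.mul (hc.comp hφ)
  · let e : (Fin 4 → ℝ) ≃ₜ (Fin 4 → ℝ) := Homeomorph.piCongrRight fun i =>
      if i = 0 then Homeomorph.mulRight₀ (ε ^ 2)⁻¹ (by positivity)
      else Homeomorph.mulRight₀ ε⁻¹ (by positivity)
    have he : ∀ z, (fun i => if i = 0 then z 0 / ε ^ 2 else z i / ε) = e z := by
      intro z
      funext i
      simp only [e, Homeomorph.piCongrRight_apply]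
      split_ifs with h
      · rw [h]; simp [div_eq_mul_inv]
      · simp [div_eq_mul_inv]
    have h1 : HasCompactSupport (ρ ∘ e) := hs.comp_homeomorph e
    have h2 : parRescale ε ρ = (fun _ => (ε ^ 5)⁻¹) * (ρ ∘ e) := by
      funext z
      simp only [parRescale, he, Pi.mul_apply, Function.comp_apply]
    rw [h2]
    exact h1.mul_left
  · simp only [parRescale]
    rw [integral_const_mul, integral_comp_parabolic_dilation hc hε, hi]
    field_simp
  · simp only [parRescale, abs_mul]
    rw [integral_const_mul, integral_comp_parabolic_dilation hc.abs hε,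
      abs_of_pos (by positivity), inv_mul_cancel_left₀ h5]
    exact le_max_right _ _
  · intro w
    rw [parRescale, abs_mul, mul_comm, abs_of_pos (by positivity : 0 < (ε ^ 5)⁻¹)]
    gcongr
    exact (hB _).trans (le_max_left _ _)
  · intro w hw
    have := hMρ _ (right_ne_zero_of_mul hw) 0
    rwa [if_pos rfl, abs_div, abs_of_pos (by positivity : 0 < ε ^ 2),
      div_le_iff₀ (by positivity)] at this
  · intro w hw i h0
    have := hMρ _ (right_ne_zero_of_mul hw) i
    rwa [if_neg h0, abs_div, abs_of_pos hε, div_le_iff₀ hε] at this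

end Mollifier

section MollifiedHeatQ

variable {A M ε : ℝ} {η : (Fin 4 → ℝ) → ℝ}

lemma heatQ_small_time (hε : 0 < ε) : ∃ S : (Fin 4 → ℝ) → ℝ, Integrable S ∧
    ∫ z, S z ≤ ε ^ 4 ∧ (∀ z, 0 ≤ S z) ∧ ∀ z, heatQ z ≤ S z + ε⁻¹ := by
  set w : ℝ → ℝ := (Set.Ioo 0 (ε ^ 2)).indicator id with hw
  have hwi : Integrable w := by
    rw [hw, integrable_indicator_iff measurableSet_Ioo]
    exact (continuous_id.integrableOn_Icc).mono_set Set.Ioo_subset_Icc_self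
  have hwpos : ∀ t, w t ≠ 0 → 0 < t := fun t ht => (Set.mem_of_indicator_ne_zero ht).1
  have hw0 : ∀ t, 0 ≤ w t := fun t => Set.indicator_nonneg (fun x hx => hx.1.le) t
  obtain ⟨h1, h2⟩ := integral_heatP_weight hwi hwpos
  refine ⟨_, h1, ?_, fun z => mul_nonneg (hw0 _) (heatP_nonneg z), fun z => ?_⟩
  · have h3 : ∫ t, w t ≤ ∫ t, (Set.Ioo 0 (ε ^ 2)).indicator (1 : ℝ → ℝ) t * ε ^ 2 := by
      refine integral_mono hwi ((integrable_indicator_Ioo _ _).mul_const _) fun t => ?_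
      by_cases ht : t ∈ Set.Ioo 0 (ε ^ 2)
      · simpa [hw, ht] using ht.2.le
      · simp [hw, ht]
    rw [integral_mul_const, integral_indicator_one measurableSet_Ioo] at h3
    simp only [Real.volume_real_Ioo_of_le (sq_nonneg ε), sub_zero] at h3
    rw [h2]
    exact h3.trans_eq (by ring)
  · have hi : 0 ≤ ε⁻¹ := by positivity
    rcases le_or_gt (z 0) 0 with h | h
    · rw [heatQ, heatP_of_nonpos h]; simpa using hi
    rcases lt_or_ge (z 0) (ε ^ 2) with h' | h'
    · rw [hw, Set.indicator_of_mem (show z 0 ∈ Set.Ioo 0 (ε ^ 2) from ⟨h, h'⟩), id, ← heatQ]; linarith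
    · have h4 : heatQ z ≤ ε⁻¹ := (heatQ_le h).trans
        (inv_anti₀ hε (Real.le_sqrt_of_sq_le h'))
      have h5 := mul_nonneg (hw0 (z 0)) (heatP_nonneg z)
      linarith

lemma heatQ_mollified_bound (hη : IsParabolicMollifier A M ε η) (hε : 0 < ε)
    (z : Fin 4 → ℝ) :
    Integrable (fun w => heatQ (z - w) * η w) ∧ |stConv heatQ η z| ≤ 2 * A / ε := by
  obtain ⟨S, hS, hSi, hS0, hQ⟩ := heatQ_small_time hε
  have hA := hη.nonneg
  have hdom : Integrable fun w => A * (ε ^ 5)⁻¹ * S (z - w) + ε⁻¹ * |η w| :=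
    ((hS.comp_sub_left z).const_mul _).add (hη.integrable.abs.const_mul _)
  have hb : ∀ w, ‖heatQ (z - w) * η w‖ ≤ A * (ε ^ 5)⁻¹ * S (z - w) + ε⁻¹ * |η w| := by
    intro w
    rw [norm_mul, Real.norm_of_nonneg (heatQ_nonneg _), Real.norm_eq_abs]
    calc _ ≤ (S (z - w) + ε⁻¹) * |η w| := by gcongr; exact hQ _
      _ = S (z - w) * |η w| + ε⁻¹ * |η w| := add_mul _ _ _
      _ ≤ S (z - w) * (A * (ε ^ 5)⁻¹) + ε⁻¹ * |η w| := by
          gcongr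
          · exact hS0 _
          · exact hη.abs_le w
      _ = _ := by ring
  constructor
  · refine hdom.mono' ?_ (Filter.Eventually.of_forall hb)
    exact ((measurable_heatQ.comp (measurable_const.sub measurable_id)).mul
      hη.continuous.measurable).aestronglyMeasurable
  · have h := norm_integral_le_of_norm_le hdom (Filter.Eventually.of_forall hb)
    rw [integral_add ((hS.comp_sub_left z).const_mul _) (hη.integrable.abs.const_mul _),
      integral_const_mul, integral_const_mul, integral_sub_left_eq_self] at h
    refine h.trans ?_
    calc _ ≤ A * (ε ^ 5)⁻¹ * ε ^ 4 + ε⁻¹ * A := by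
          gcongr
          exact hη.integral_abs_le
      _ = _ := by field_simp; ring

lemma heatQ_mollified_sub_le (hη : IsParabolicMollifier A M ε η) (hε : 0 < ε) (hM : 1 ≤ M)
    {z : Fin 4 → ℝ} (hz : 2 * M * ε ^ 2 ≤ z 0) :
    |stConv heatQ η z - heatQ z| ≤ 18 * M * A * (ε / z 0) := by
  have hz0 : 0 < z 0 := lt_of_lt_of_le (by positivity) hz
  have hr : 0 < √(z 0) := Real.sqrt_pos.2 hz0
  have hεr : ε ≤ √(z 0) := Real.le_sqrt_of_sq_le (by nlinarith [sq_nonneg ε])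
  have hb : ∀ w, ‖(heatQ (z - w) - heatQ z) * η w‖ ≤ 18 * M * (ε / z 0) * |η w| := by
    intro w
    rw [norm_mul, Real.norm_eq_abs, Real.norm_eq_abs]
    by_cases hw : η w = 0
    · simp [hw]
    have ht := hη.abs_time_le w hw
    have hx := hη.abs_space_le w hw
    gcongr
    have h := abs_heatQ_sub_le (z := z) (w := z - w) hz0 (by
      rw [Pi.sub_apply, sub_sub_cancel]; linarith)
    simp only [Pi.sub_apply, sub_sub_cancel, sub_sub_cancel_left, abs_neg] at h
    refine h.trans ?_
    have h1 : 12 * |w 0| / (z 0 * √(z 0)) ≤ 12 * (M * ε) / z 0 := by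
      rw [div_le_div_iff₀ (by positivity) hz0]
      have : |w 0| ≤ M * ε * √(z 0) := ht.trans (by
        rw [sq, ← mul_assoc]; gcongr)
      nlinarith
    have h2 : 2 * (|w 1| + |w 2| + |w 3|) / z 0 ≤ 6 * (M * ε) / z 0 := by
      refine div_le_div_of_nonneg_right ?_ hz0.le
      linarith [hx 1 (by decide), hx 2 (by decide), hx 3 (by decide)]
    calc _ ≤ 12 * (M * ε) / z 0 + 6 * (M * ε) / z 0 := add_le_add h1 h2
      _ = _ := by ring
  have he : stConv heatQ η z - heatQ z = ∫ w, (heatQ (z - w) - heatQ z) * η w := by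
    simp only [sub_mul]
    rw [integral_sub (heatQ_mollified_bound hη hε z).1 (hη.integrable.const_mul _),
      integral_const_mul, hη.integral_eq_one, mul_one, stConv]
  rw [he]
  refine (norm_integral_le_of_norm_le (hη.integrable.abs.const_mul _)
    (Filter.Eventually.of_forall hb)).trans ?_
  rw [integral_const_mul]
  have h0 : 0 ≤ 18 * M * (ε / z 0) := by positivity
  exact (mul_le_mul_of_nonneg_left hη.integral_abs_le h0).trans_eq (by ring)

lemma heatQ_mollified_off_ball (A : ℝ) {M δ : ℝ} (hM : 1 ≤ M) (hδ : 0 < δ) :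
    ∃ C, ∀ ε η, 0 < ε → ε ≤ 1 → IsParabolicMollifier A M ε η → ∀ z : Fin 4 → ℝ, δ ≤ ‖z‖ →
      |stConv heatQ η z| ≤ C := by
  obtain ⟨C, hC1, hC⟩ := heatQ_bounded_off_ball (half_pos hδ)
  refine ⟨max (C * A) (2 * A * (2 * M / δ)), fun ε η hε hε1 hη z hz => ?_⟩
  rcases le_or_gt (M * ε) (δ / 2) with h | h
  · refine le_max_of_le_left ?_
    have hb : ∀ w, ‖heatQ (z - w) * η w‖ ≤ C * |η w| := by
      intro w
      rw [norm_mul, Real.norm_of_nonneg (heatQ_nonneg _), Real.norm_eq_abs]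
      by_cases hw : η w = 0
      · simp [hw]
      gcongr
      refine hC _ ?_
      have hwn : ‖w‖ ≤ M * ε := by
        rw [pi_norm_le_iff_of_nonneg (by positivity)]
        intro i
        rw [Real.norm_eq_abs]
        by_cases hi : i = 0
        · rw [hi]
          refine (hη.abs_time_le w hw).trans ?_
          gcongr
          nlinarith
        · exact hη.abs_space_le w hw i hi
      have := norm_sub_norm_le z w
      linarith
    refine (norm_integral_le_of_norm_le (hη.integrable.abs.const_mul _)
      (Filter.Eventually.of_forall hb)).trans ?_
    rw [integral_const_mul]
    exact mul_le_mul_of_nonneg_left hη.integral_abs_le (by linarith)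
  · refine le_max_of_le_right ((heatQ_mollified_bound hη hε z).2.trans ?_)
    have hA := hη.nonneg
    rw [div_eq_mul_inv]
    gcongr
    rw [inv_le_comm₀ hε (by positivity), inv_div, div_le_iff₀ (by positivity)]
    linarith

/-- Bounds for a mollified kernel which differs from `heatQ` by a bounded amount. -/
lemma exists_mollified_bounds {G : (Fin 4 → ℝ) → ℝ} (hG : Integrable G) {B : ℝ}
    (hGB : ∀ᵐ z, |G z - heatQ z| ≤ B) (A : ℝ) {M δ : ℝ} (hM : 1 ≤ M) (hδ : 0 < δ) :
    ∃ C, 0 ≤ C ∧ ∀ ε η, 0 < ε → ε ≤ 1 → IsParabolicMollifier A M ε η →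
      (∀ z, |stConv G η z| ≤ C / ε) ∧
      (∀ z, 2 * M * ε ^ 2 ≤ z 0 → |stConv G η z - heatQ z| ≤ C * (ε / z 0 + 1)) ∧
      (∀ z, δ ≤ ‖z‖ → |stConv G η z| ≤ C) := by
  obtain ⟨C₁, hC₁⟩ := heatQ_mollified_off_ball A hM hδ
  refine ⟨|B| * |A| + 2 * |A| + 18 * M * |A| + |C₁|, by positivity,
    fun ε η hε hε1 hη => ?_⟩
  have hA := hη.nonneg
  have hdiff : ∀ z, |stConv G η z - stConv heatQ η z| ≤ |B| * |A| := by
    intro z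
    have h1 := integrable_mul_of_bounded hG hη.continuous.aestronglyMeasurable hη.abs_le z
    have h2 := (heatQ_mollified_bound hη hε z).1
    rw [stConv, stConv, ← integral_sub h1 h2]
    have hae : ∀ᵐ w, |G (z - w) - heatQ (z - w)| ≤ B :=
      (Measure.measurePreserving_sub_left volume z).quasiMeasurePreserving.ae hGB
    rw [← Real.norm_eq_abs]
    refine (norm_integral_le_of_norm_le (hη.integrable.abs.const_mul |B|) ?_).trans ?_
    · filter_upwards [hae] with w hw
      rw [← sub_mul, norm_mul, Real.norm_eq_abs, Real.norm_eq_abs]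
      exact mul_le_mul_of_nonneg_right (hw.trans (le_abs_self B)) (abs_nonneg _)
    · rw [integral_const_mul]
      gcongr
      exact hη.integral_abs_le.trans (le_abs_self A)
  have hBA : 0 ≤ |B| * |A| := by positivity
  have hMA : 0 ≤ 18 * M * |A| := by positivity
  rw [← abs_of_nonneg hA] at hη
  refine ⟨fun z => ?_, fun z hz => ?_, fun z hz => ?_⟩
  · have h1 := abs_sub_abs_le_abs_sub (stConv G η z) (stConv heatQ η z)
    have h2 := hdiff z
    have h3 := (heatQ_mollified_bound hη hε z).2
    rw [le_div_iff₀ hε] at h3 ⊢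
    nlinarith [abs_nonneg C₁]
  · have hz0 : 0 < z 0 := lt_of_lt_of_le (by positivity) hz
    have h1 := abs_sub_le (stConv G η z) (stConv heatQ η z) (heatQ z)
    have h2 := hdiff z
    have h3 := heatQ_mollified_sub_le hη hε hM hz
    have h4 : 0 < ε / z 0 := by positivity
    have h5 : 0 ≤ (|B| * |A| + 2 * |A| + |C₁|) * (ε / z 0) := by positivity
    have h6 : 0 ≤ 2 * |A| + |C₁| := by positivity
    nlinarith
  · have h1 := abs_sub_abs_le_abs_sub (stConv G η z) (stConv heatQ η z)
    have h2 := hdiff z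
    rw [abs_of_nonneg hA] at hη
    have h3 := (hC₁ ε η hε hε1 hη z hz).trans (le_abs_self C₁)
    have h4 : 0 ≤ 2 * |A| := by positivity
    linarith

end MollifiedHeatQ

section LogDivergence

/-- A weight dominating the error in the logarithmic asymptotics, with its integral. -/
lemma exists_error_weight {ε M : ℝ} (hε : 0 < ε) (hM : 1 ≤ M) {a b : ℝ} (hb : 0 ≤ b) :
    ∃ h : ℝ → ℝ, Integrable h ∧ (∀ t, h t ≠ 0 → 0 < t) ∧
      (∀ t, h t = (Set.Ioo 0 (M * ε ^ 2)).indicator (1 : ℝ → ℝ) t * (a / ε ^ 2) +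
        b * ((Set.Ici (M * ε ^ 2)).indicator (fun t => ε * t ^ (-(3 / 2) : ℝ)) t +
          (Set.Ioo 0 1).indicator (fun t : ℝ => t ^ (-(1 / 2) : ℝ)) t)) ∧
      ∫ t, h t ≤ a * M + b * 4 := by
  set T := M * ε ^ 2 with hT
  have hT0 : 0 < T := by positivity
  have i1 := (integrable_indicator_Ioo 0 T).mul_const (a / ε ^ 2)
  have i2 : Integrable ((Set.Ici T).indicator fun t : ℝ => ε * t ^ (-(3 / 2) : ℝ)) := by
    rw [integrable_indicator_iff measurableSet_Ici, integrableOn_Ici_iff_integrableOn_Ioi]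
    exact (integrableOn_Ioi_rpow_of_lt (by norm_num) hT0).const_mul ε
  have i3 : Integrable ((Set.Ioo 0 1).indicator fun t : ℝ => t ^ (-(1 / 2) : ℝ)) := by
    rw [integrable_indicator_iff measurableSet_Ioo, ← integrableOn_Ioc_iff_integrableOn_Ioo,
      ← intervalIntegrable_iff_integrableOn_Ioc_of_le zero_le_one]
    exact intervalIntegral.intervalIntegrable_rpow' (by norm_num)
  refine ⟨_, i1.add ((i2.add i3).const_mul b), fun t ht => ?_, fun t => rfl, ?_⟩
  · by_contra h0
    refine ht ?_
    have n1 : t ∉ Set.Ioo 0 T := fun h => h0 h.1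
    have n2 : t ∉ Set.Ici T := fun h => h0 (hT0.trans_le h)
    have n3 : t ∉ Set.Ioo (0 : ℝ) 1 := fun h => h0 h.1
    simp [n1, n2, n3]
  · have e1 : ∫ t, (Set.Ioo 0 T).indicator (1 : ℝ → ℝ) t * (a / ε ^ 2) = a * M := by
      rw [integral_mul_const, integral_indicator_one measurableSet_Ioo,
        Real.volume_real_Ioo_of_le hT0.le, sub_zero, hT]
      field_simp
    have e2 : ∫ t, (Set.Ici T).indicator (fun t : ℝ => ε * t ^ (-(3 / 2) : ℝ)) t ≤ 2 := by
      rw [integral_indicator measurableSet_Ici, integral_Ici_eq_integral_Ioi,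
        integral_const_mul, integral_Ioi_rpow_of_lt (by norm_num) hT0]
      have h1 : T ^ (-(3 / 2) + 1 : ℝ) = (√T)⁻¹ := by
        rw [Real.sqrt_eq_rpow, ← Real.rpow_neg hT0.le]; norm_num
      have h2 : ε ≤ √T := Real.le_sqrt_of_sq_le (by nlinarith [sq_nonneg ε])
      have h3 : ε * (√T)⁻¹ ≤ 1 := by
        rw [← div_eq_mul_inv]; exact div_le_one_of_le₀ h2 (Real.sqrt_nonneg _)
      have h4 : -(√T)⁻¹ / (-(3 / 2) + 1 : ℝ) = 2 * (√T)⁻¹ := by ring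
      rw [h1, h4]
      linarith
    have e3 : ∫ t, (Set.Ioo 0 1).indicator (fun t : ℝ => t ^ (-(1 / 2) : ℝ)) t = 2 := by
      rw [integral_indicator measurableSet_Ioo, ← integral_Ioc_eq_integral_Ioo,
        ← intervalIntegral.integral_of_le zero_le_one, integral_rpow (Or.inl (by norm_num))]
      norm_num
    have e4 := integral_add i1 ((i2.add i3).const_mul b)
    rw [integral_const_mul] at e4
    have e5 := integral_add i2 i3
    simp only [Pi.add_apply] at e4 e5 ⊢
    rw [e4, e5, e1, e3]
    nlinarith

lemma abs_max_log_sub_le {ε M : ℝ} (hε : 0 < ε) (hε1 : ε ≤ 1) (hM : 1 ≤ M) :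
    |max 0 (Real.log (1 / (M * ε ^ 2))) - 2 * Real.log (1 / ε)| ≤ Real.log M := by
  have h1 : Real.log (1 / (M * ε ^ 2)) = 2 * Real.log (1 / ε) - Real.log M := by
    rw [one_div, one_div, Real.log_inv, Real.log_inv, Real.log_mul (by positivity) (by positivity),
      Real.log_pow]
    push_cast; ring
  have h2 : 0 ≤ Real.log (1 / ε) := Real.log_nonneg ((one_le_div hε).2 hε1)
  have h3 := Real.log_nonneg hM
  rw [h1]
  rcases max_cases 0 (2 * Real.log (1 / ε) - Real.log M) with h | h <;>
    rw [h.1, abs_le] <;> constructor <;> linarith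

lemma abs_sq_sub_sq_le {C ε t g q : ℝ} (hC : 0 ≤ C) (hε : 0 < ε) (ht : 0 < t) (ht1 : t ≤ 1)
    (hεt : ε ^ 2 ≤ t) (hg : |g - q| ≤ C * (ε / t + 1)) (hq0 : 0 ≤ q) (hq : q ≤ (√t)⁻¹) :
    |g ^ 2 - q ^ 2| ≤ C * (2 * C + 2) * (ε * t ^ (-(3 / 2) : ℝ) + t ^ (-(1 / 2) : ℝ)) := by
  have hr : 0 < √t := Real.sqrt_pos.2 ht
  have e1 : t ^ (-(1 / 2) : ℝ) = (√t)⁻¹ := by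
    rw [Real.sqrt_eq_rpow, ← Real.rpow_neg ht.le]
  have e2 : t ^ (-(3 / 2) : ℝ) = t⁻¹ * (√t)⁻¹ := by
    rw [← e1, ← Real.rpow_neg_one, ← Real.rpow_add ht]; norm_num
  have h1 : ε / t ≤ (√t)⁻¹ := by
    rw [div_le_iff₀ ht]
    nth_rewrite 2 [← Real.sq_sqrt ht.le]
    have : (√t)⁻¹ * √t ^ 2 = √t := by field_simp
    rw [this]
    exact Real.le_sqrt_of_sq_le hεt
  have h2 : 1 ≤ (√t)⁻¹ := (one_le_inv₀ hr).2 (Real.sqrt_le_one.2 ht1)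
  have hd : |g - q| ≤ C * (2 * (√t)⁻¹) := hg.trans (by gcongr; linarith)
  have hs : |g + q| ≤ (2 * C + 2) * (√t)⁻¹ := by
    have e : g + q = (g - q) + 2 * q := by ring
    rw [e]
    refine (abs_add_le _ _).trans ?_
    rw [abs_of_nonneg (by positivity : 0 ≤ 2 * q)]
    nlinarith
  have e3 : g ^ 2 - q ^ 2 = (g - q) * (g + q) := by ring
  rw [e3, abs_mul, e1, e2]
  calc _ ≤ (C * (ε / t + 1)) * ((2 * C + 2) * (√t)⁻¹) := by gcongr
    _ = _ := by ring

/-- Logarithmic asymptotics of `∫ K g²` for a kernel `g` approximating `heatQ` at scale `ε`. -/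
lemma abs_integral_sub_log_le {K g : (Fin 4 → ℝ) → ℝ} {C M ε : ℝ}
    (hK : Integrable K) (hKball : ∀ z : Fin 4 → ℝ, ‖z‖ < 1 / 16 → K z = heatP₁ z)
    (hgm : AEStronglyMeasurable g) (hC : 0 ≤ C) (hM : 1 ≤ M) (hε : 0 < ε) (hε1 : ε ≤ 1)
    (h1 : ∀ z, |g z| ≤ C / ε)
    (h2 : ∀ z, M * ε ^ 2 ≤ z 0 → |g z - heatQ z| ≤ C * (ε / z 0 + 1))
    (h3 : ∀ z, 1 / 16 ≤ ‖z‖ → |g z| ≤ C) :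
    |(∫ z, K z * g z ^ 2) - 2 * logConst * Real.log (1 / ε)| ≤
      C ^ 2 * M + C * (2 * C + 2) * 4 + C ^ 2 * (∫ z, |K z - heatP₁ z|) +
        logConst * Real.log M := by
  set T := M * ε ^ 2 with hT
  have hT0 : 0 < T := by positivity
  have hεT : ε ^ 2 ≤ T := by nlinarith [sq_nonneg ε]
  obtain ⟨mi, mv⟩ := integral_heatP_heatQ_sq hT0
  set m : (Fin 4 → ℝ) → ℝ := fun z =>
    (Set.Ico T 1).indicator (1 : ℝ → ℝ) (z 0) * (heatP z * heatQ z ^ 2) with hm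
  obtain ⟨h, hi, hpos, hval, hint⟩ := exists_error_weight (a := C ^ 2) (b := C * (2 * C + 2))
    hε hM (by positivity)
  obtain ⟨wi, wv⟩ := integral_heatP_weight hi hpos
  have hR := (hK.sub integrable_heatP₁).abs.const_mul (C ^ 2)
  have hb0 : 0 ≤ C * (2 * C + 2) := by positivity
  have hi2 : ∀ t, 0 ≤ (Set.Ici T).indicator (fun t => ε * t ^ (-(3 / 2) : ℝ)) t := fun t =>
    Set.indicator_nonneg (fun x hx => mul_nonneg hε.le
      (Real.rpow_nonneg (hT0.le.trans hx) _)) t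
  have hi3 : ∀ t : ℝ, 0 ≤ (Set.Ioo 0 1).indicator (fun t : ℝ => t ^ (-(1 / 2) : ℝ)) t := fun t =>
    Set.indicator_nonneg (fun x hx => Real.rpow_nonneg hx.1.le _) t
  have hi1 : ∀ t : ℝ, 0 ≤ (Set.Ioo 0 T).indicator (1 : ℝ → ℝ) t * (C ^ 2 / ε ^ 2) := fun t =>
    mul_nonneg (Set.indicator_nonneg (fun _ _ => zero_le_one) t) (by positivity)
  have hh0 : ∀ t, 0 ≤ h t := fun t => by
    rw [hval]
    exact add_nonneg (hi1 t) (mul_nonneg hb0 (add_nonneg (hi2 t) (hi3 t)))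
  have hgsq : ∀ z, g z ^ 2 ≤ C ^ 2 / ε ^ 2 := fun z => by
    rw [← div_pow, ← sq_abs]
    exact pow_le_pow_left₀ (abs_nonneg _) (h1 z) 2
  have hmain : ∀ z, |heatP₁ z * g z ^ 2 - m z| ≤ h (z 0) * heatP z := by
    intro z
    have hP := heatP_nonneg z
    by_cases hz : z 0 ∈ Set.Ioo (0 : ℝ) 1
    · have e1 : heatP₁ z = heatP z := by simp [heatP₁, hz]
      rw [e1]
      rcases lt_or_ge (z 0) T with hzT | hzT
      · have n : z 0 ∉ Set.Ico T 1 := fun hh => absurd hh.1 hzT.not_ge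
        have e2 : m z = 0 := by simp [hm, n]
        rw [e2, sub_zero, abs_of_nonneg (by positivity), mul_comm]
        gcongr
        rw [hval, Set.indicator_of_mem (show z 0 ∈ Set.Ioo 0 T from ⟨hz.1, hzT⟩), Pi.one_apply,
          one_mul]
        linarith [hgsq z, mul_nonneg hb0 (add_nonneg (hi2 (z 0)) (hi3 (z 0)))]
      · have e2 : m z = heatP z * heatQ z ^ 2 := by
          simp only [hm]
          rw [Set.indicator_of_mem (show z 0 ∈ Set.Ico T 1 from ⟨hzT, hz.2⟩), Pi.one_apply, one_mul]
        rw [e2, ← mul_sub, abs_mul, abs_of_nonneg hP, mul_comm]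
        gcongr
        refine (abs_sq_sub_sq_le hC hε hz.1 hz.2.le (hεT.trans hzT) (h2 z hzT)
          (heatQ_nonneg z) (heatQ_le hz.1)).trans ?_
        rw [hval, Set.indicator_of_mem (show z 0 ∈ Set.Ici T from hzT), Set.indicator_of_mem hz]
        linarith [hi1 (z 0)]
    · have e1 : heatP₁ z = 0 := by simp [heatP₁, hz]
      have n : z 0 ∉ Set.Ico T 1 := fun hh => hz ⟨hT0.trans_le hh.1, hh.2⟩
      have e2 : m z = 0 := by simp [hm, n]
      rw [e1, e2]
      simpa using mul_nonneg (hh0 _) hP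
  have hrest : ∀ z, |(K z - heatP₁ z) * g z ^ 2| ≤ C ^ 2 * |K z - heatP₁ z| := by
    intro z
    rcases lt_or_ge ‖z‖ (1 / 16) with hz | hz
    · simp [hKball z hz]
    · rw [abs_mul, mul_comm, abs_of_nonneg (sq_nonneg (g z)), ← sq_abs]
      gcongr
      exact h3 z hz
  have hdom : ∀ z, ‖K z * g z ^ 2 - m z‖ ≤ h (z 0) * heatP z + C ^ 2 * |K z - heatP₁ z| := by
    intro z
    have e : K z * g z ^ 2 - m z =
        (heatP₁ z * g z ^ 2 - m z) + (K z - heatP₁ z) * g z ^ 2 := by ring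
    rw [e, Real.norm_eq_abs]
    exact (abs_add_le _ _).trans (add_le_add (hmain z) (hrest z))
  have hdi : Integrable fun z => h (z 0) * heatP z + C ^ 2 * |K z - heatP₁ z| := wi.add hR
  have hKg : Integrable fun z => K z * g z ^ 2 - m z :=
    hdi.mono' ((hK.aestronglyMeasurable.mul (hgm.pow 2)).sub mi.aestronglyMeasurable)
      (Filter.Eventually.of_forall hdom)
  have hfin := norm_integral_le_of_norm_le hdi (Filter.Eventually.of_forall hdom)
  have e1 : ∫ z, K z * g z ^ 2 = (∫ z, (K z * g z ^ 2 - m z)) + ∫ z, m z := by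
    rw [← integral_add hKg mi]
    simp
  have e2 : ∫ z, (h (z 0) * heatP z + C ^ 2 * |K z - heatP₁ z|) =
      (∫ t, h t) + C ^ 2 * ∫ z, |K z - heatP₁ z| := by
    rw [← wv, ← integral_const_mul]
    exact integral_add wi hR
  rw [e2, Real.norm_eq_abs] at hfin
  have hlog := mul_le_mul_of_nonneg_left (abs_max_log_sub_le hε hε1 hM) logConst_pos.le
  rw [← abs_of_pos logConst_pos, ← abs_mul, abs_of_pos logConst_pos] at hlog
  have e3 : (∫ z, K z * g z ^ 2) - 2 * logConst * Real.log (1 / ε) =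
      (∫ z, (K z * g z ^ 2 - m z)) +
        logConst * (max 0 (Real.log (1 / T)) - 2 * Real.log (1 / ε)) := by
    rw [e1, mv]; ring
  rw [e3]
  refine (abs_add_le _ _).trans ?_
  linarith

end LogDivergence

section TruncatedKernel

lemma stConv_congr_left {f f' : (Fin 4 → ℝ) → ℝ} (h : f =ᵐ[volume] f') (g : (Fin 4 → ℝ) → ℝ) :
    stConv f g = stConv f' g := by
  funext z
  refine integral_congr_ae ?_
  filter_upwards
    [(Measure.measurePreserving_sub_left volume z).quasiMeasurePreserving.ae_eq_comp h] with w hw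
  simp only [Function.comp_apply] at hw
  rw [hw]

lemma pnorm_le_half {z : Fin 4 → ℝ} (hz : ‖z‖ < 1 / 16) : pnorm z ≤ 1 / 2 := by
  have h : ∀ i, |z i| ≤ 1 / 16 := fun i => (norm_le_pi_norm z i).trans hz.le
  have hsq : ∀ i, z i ^ 2 ≤ 1 / 256 := fun i => by
    rw [← sq_abs]
    nlinarith [h i, abs_nonneg (z i)]
  have h1 : √|z 0| ≤ 1 / 4 := Real.sqrt_le_iff.2 ⟨by norm_num, by linarith [h 0]⟩
  have h2 : √(z 1 ^ 2 + z 2 ^ 2 + z 3 ^ 2) ≤ 1 / 4 :=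
    Real.sqrt_le_iff.2 ⟨by norm_num, by linarith [hsq 1, hsq 2, hsq 3]⟩
  rw [pnorm]
  linarith

lemma pnorm_pos {z : Fin 4 → ℝ} (hz : z ≠ 0) : 0 < pnorm z := by
  by_contra! h
  have h0 := Real.sqrt_nonneg |z 0|
  have h1 := Real.sqrt_nonneg (z 1 ^ 2 + z 2 ^ 2 + z 3 ^ 2)
  rw [pnorm] at h
  have e0 : z 0 = 0 := abs_eq_zero.1
    ((Real.sqrt_eq_zero (abs_nonneg _)).1 (by linarith))
  have e1 : z 1 ^ 2 + z 2 ^ 2 + z 3 ^ 2 = 0 := (Real.sqrt_eq_zero (by positivity)).1 (by linarith)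
  refine hz (funext fun i => ?_)
  fin_cases i
  · exact e0
  all_goals
    refine pow_eq_zero_iff two_ne_zero |>.1 ?_
    simp only [Fin.mk_one, Fin.reduceFinMk]
    nlinarith [sq_nonneg (z 1), sq_nonneg (z 2), sq_nonneg (z 3)]

lemma heatP₁_eq_heatP {z : Fin 4 → ℝ} (hz : ‖z‖ < 1) : heatP₁ z = heatP z := by
  have h := (le_abs_self _).trans_lt ((norm_le_pi_norm z 0).trans_lt hz)
  by_cases h0 : 0 < z 0
  · rw [heatP₁, Set.indicator_of_mem (show z 0 ∈ Set.Ioo 0 1 from ⟨h0, h⟩), Pi.one_apply, one_mul]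
  · rw [heatP₁, heatP_of_nonpos (not_lt.1 h0), mul_zero]

/-- A truncation of the heat kernel agrees almost everywhere with a kernel at bounded distance
from `heatP₁`. -/
lemma exists_ae_eq_sub_heatP₁_le {K : (Fin 4 → ℝ) → ℝ} (hc : ContinuousOn K {(0 : Fin 4 → ℝ)}ᶜ)
    (hs : HasCompactSupport K)
    (hK : ∀ z : Fin 4 → ℝ, 0 < pnorm z → pnorm z ≤ 1 / 2 → K z = heatP z) :
    ∃ K' : (Fin 4 → ℝ) → ℝ, K =ᵐ[volume] K' ∧ Integrable K' ∧
      (∀ z : Fin 4 → ℝ, ‖z‖ < 1 / 16 → K' z = heatP₁ z) ∧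
      ∃ C, ∀ z, |K' z - heatP₁ z| ≤ C := by
  set b : Set (Fin 4 → ℝ) := Metric.ball 0 (1 / 16) with hb
  set S : Set (Fin 4 → ℝ) := tsupport K \ b with hS
  have hbK : ∀ z ∈ b, z ≠ 0 → K z = heatP₁ z := fun z hz h0 => by
    rw [hb, mem_ball_zero_iff] at hz
    rw [heatP₁_eq_heatP (by linarith), hK z (pnorm_pos h0) (pnorm_le_half hz)]
  have hScomp : IsCompact S := hs.isCompact.diff Metric.isOpen_ball
  have hS0 : S ⊆ {(0 : Fin 4 → ℝ)}ᶜ := fun z hz h => hz.2 (by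
    rw [Set.mem_singleton_iff.1 h]
    exact Metric.mem_ball_self (by norm_num))
  have hKS : IntegrableOn K S := (hc.mono hS0).integrableOn_compact hScomp
  obtain ⟨C₁, hC₁⟩ := hScomp.exists_bound_of_continuousOn (hc.mono hS0)
  obtain ⟨C₂, hC₂, hP⟩ := heatP_bounded_off_ball (δ := 1 / 16) (by norm_num)
  have hin : ∀ z ∈ b, b.indicator heatP₁ z + S.indicator K z = heatP₁ z := fun z hz => by
    rw [Set.indicator_of_mem hz, Set.indicator_of_notMem (fun h => h.2 hz), add_zero]
  have hout : ∀ z, z ∉ b → b.indicator heatP₁ z + S.indicator K z = S.indicator K z := fun z hz => by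
    rw [Set.indicator_of_notMem hz, zero_add]
  refine ⟨fun z => b.indicator heatP₁ z + S.indicator K z, ?_, ?_, fun z hz => ?_,
    |C₁| + C₂, fun z => ?_⟩
  · filter_upwards [compl_mem_ae_iff.2 (measure_singleton (0 : Fin 4 → ℝ))] with z hz
    by_cases hzb : z ∈ b
    · rw [hin z hzb, hbK z hzb hz]
    · rw [hout z hzb]
      by_cases hzS : z ∈ tsupport K
      · rw [Set.indicator_of_mem (show z ∈ S from ⟨hzS, hzb⟩)]
      · rw [image_eq_zero_of_notMem_tsupport hzS, Set.indicator_of_notMem (fun h => hzS h.1)]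
  · exact (integrable_heatP₁.indicator Metric.isOpen_ball.measurableSet).add
      (hKS.integrable_indicator hScomp.measurableSet)
  · exact hin z (mem_ball_zero_iff.2 hz)
  · beta_reduce
    by_cases hzb : z ∈ b
    · rw [hin z hzb, sub_self, abs_zero]
      positivity
    · rw [hout z hzb]
      have h1 : |S.indicator K z| ≤ |C₁| := by
        by_cases hzS : z ∈ S
        · rw [Set.indicator_of_mem hzS]
          exact (hC₁ z hzS).trans (le_abs_self _)
        · simp [hzS]
      have h2 : |heatP₁ z| ≤ C₂ := by
        rw [abs_of_nonneg (heatP₁_nonneg z)]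
        exact (heatP₁_le_heatP z).trans (hP z (not_lt.1 fun h => hzb (mem_ball_zero_iff.2 h)))
      exact (abs_sub _ _).trans (add_le_add h1 h2)

lemma ae_abs_stConv_sub_heatQ_le {K : (Fin 4 → ℝ) → ℝ} (hK : Integrable K) {C : ℝ}
    (hC : ∀ z, |K z - heatP₁ z| ≤ C) :
    ∃ B, ∀ᵐ z, |stConv K K z - heatQ z| ≤ B := by
  set R : (Fin 4 → ℝ) → ℝ := fun z => K z - heatP₁ z with hR
  have hRi : Integrable R := hK.sub integrable_heatP₁
  refine ⟨C * (∫ w, |K w|) + C * (∫ w, |heatP₁ w|) + 1, ?_⟩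
  filter_upwards [integrable_heatP₁.ae_convolution_exists (ContinuousLinearMap.mul ℝ ℝ)
    integrable_heatP₁] with z hz
  have i3 : Integrable fun w => heatP₁ (z - w) * heatP₁ w :=
    hz.congr (Filter.Eventually.of_forall fun w => mul_comm _ _)
  have i2 : Integrable fun w => heatP₁ (z - w) * R w :=
    integrable_mul_of_bounded integrable_heatP₁ hRi.aestronglyMeasurable hC z
  have i1 : Integrable fun w => R (z - w) * K w := by
    have := (integrable_mul_of_bounded hK hRi.aestronglyMeasurable hC z).comp_sub_left z
    simpa only [sub_sub_cancel, mul_comm] using this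
  have b1 : |stConv K R z| ≤ _ := abs_stConv_le_of_bounded hK hC z
  have b2 : |stConv heatP₁ R z| ≤ _ := abs_stConv_le_of_bounded integrable_heatP₁ hC z
  have b3 := abs_heatP₁_conv_sub_heatQ_le z
  have e : stConv K K z = stConv R K z + stConv heatP₁ R z + stConv heatP₁ heatP₁ z := by
    have hw : ∀ w, K (z - w) * K w =
        R (z - w) * K w + heatP₁ (z - w) * R w + heatP₁ (z - w) * heatP₁ w := fun w => by
      simp only [hR]; ring
    simp only [stConv, hw]
    have i12 : Integrable fun w => R (z - w) * K w + heatP₁ (z - w) * R w := i1.add i2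
    rw [integral_add i12 i3, integral_add i1 i2]
  rw [stConv_comm R K] at e
  rw [e, add_sub_assoc]
  exact (abs_add_three _ _ _).trans (add_le_add (add_le_add b1 b2) b3)

lemma stConv_mollified_self {K η : (Fin 4 → ℝ) → ℝ} (hK : Integrable K) (hη : Integrable η) {B : ℝ}
    (hB : ∀ w, |η w| ≤ B) :
    stConv (stConv K η) (stConv K η) = stConv (stConv K K) (stConv η η) := by
  have h := abs_stConv_le_of_bounded hK hB
  have h' := abs_stConv_le_of_bounded hη hB
  rw [stConv_assoc hK hη (integrable_stConv hK hη) h, ← stConv_comm (stConv K η) η,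
    stConv_assoc hK hη hη hB, ← stConv_assoc hK hK (integrable_stConv hη hη) h']

end TruncatedKernel

/-- With `K_ε = K*ρ_ε` and `G_ε = K_ε*K_ε`, the renormalisation constant
`C₂^{(ε)} = ∫ K·G_ε²` satisfies `|C₂^{(ε)} − c₂·log(1/ε)| ≤ C` for all `ε ∈ (0,1/2]`,
for some constants `c₂ > 0` and `C`. -/
theorem stmt_14 (ρ K : (Fin 4 → ℝ) → ℝ)
    (hρ_smooth : ContDiff ℝ (⊤ : ℕ∞) ρ) (hρ_supp : HasCompactSupport ρ)
    (hρ_int : ∫ z, ρ z = 1)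
    (hK_smooth : ContDiffOn ℝ (⊤ : ℕ∞) K {(0 : Fin 4 → ℝ)}ᶜ)
    (hK_supp : HasCompactSupport K)
    (hK_eq : ∀ z : Fin 4 → ℝ, 0 < pnorm z → pnorm z ≤ 1 / 2 → K z = heatP z)
    (hK_bound : ∀ l : Fin 4 → ℕ, ∃ Cl : ℝ, ∀ z : Fin 4 → ℝ, z ≠ 0 →
      |Dmulti l K z| ≤ Cl * pnorm z ^ (-(3 : ℝ) - pdeg l)) :
    ∃ c₂ : ℝ, 0 < c₂ ∧ ∃ C : ℝ, ∀ ε : ℝ, 0 < ε → ε ≤ 1 / 2 →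
      |(∫ z : Fin 4 → ℝ, K z *
          (stConv (stConv K (parRescale ε ρ)) (stConv K (parRescale ε ρ)) z) ^ 2)
        - c₂ * Real.log (1 / ε)| ≤ C := by
  obtain ⟨K', hae, hK'i, hK'b, C₀, hC₀⟩ :=
    exists_ae_eq_sub_heatP₁_le hK_smooth.continuousOn hK_supp hK_eq
  obtain ⟨A, M, hM, hη⟩ := exists_isParabolicMollifier hρ_smooth.continuous hρ_supp hρ_int
  obtain ⟨B, hB⟩ := ae_abs_stConv_sub_heatQ_le hK'i hC₀
  obtain ⟨C, hC, hbd⟩ := exists_mollified_bounds (integrable_stConv hK'i hK'i) hB (A * A)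
    (M := 2 * M) (δ := 1 / 16) (by linarith) (by norm_num)
  refine ⟨2 * logConst, mul_pos two_pos logConst_pos, C ^ 2 * (2 * (2 * M)) +
    C * (2 * C + 2) * 4 + C ^ 2 * (∫ z, |K' z - heatP₁ z|) + logConst * Real.log (2 * (2 * M)),
    fun ε hε hε2 => ?_⟩
  have hε1 : ε ≤ 1 := by linarith
  have hηε := hη ε hε
  have hηη := hηε.stConv hηε
  obtain ⟨h1, h2, h3⟩ := hbd ε _ hε hε1 hηη
  rw [stConv_congr_left hae, stConv_mollified_self hK'i hηε.integrable hηε.abs_le]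
  have e : ∀ g : (Fin 4 → ℝ) → ℝ, ∫ z, K z * g z ^ 2 = ∫ z, K' z * g z ^ 2 := fun g =>
    integral_congr_ae (by filter_upwards [hae] with z hz using by rw [hz])
  rw [e]
  exact abs_integral_sub_log_le hK'i hK'b
    (integrable_stConv (integrable_stConv hK'i hK'i) hηη.integrable).aestronglyMeasurable
    hC (by linarith) hε hε1 h1 h2 h3
end

section
/- Fix ζ ∈ (1,2), a ∈ ℝ, ε ∈ (0,1) and K ≥ 0, and let Λ be a linear functional on the space of compactly supported C³ functions on ℝ×ℝ³. For R > 0 let B_R denote the set of C³ functions φ : ℝ×ℝ³ → ℝ supported in the parabolic ball {‖z‖ ≤ R} with all partial derivatives up to order 3 (including the function itself) bounded by 1. Assume: (i) |Λ(ψ^λ)| ≤ K·λ^ζ·ε^{a−ζ} for every λ ∈ (0,ε] and every ψ ∈ B₂ satisfying ∫ψ dz = 0 and ∫ψ(t,x)·x_i dz = 0 for i = 1,2,3; and (ii) |Λ(φ^λ)| ≤ K·λ^a for every λ ∈ (0,1] and every φ ∈ B₂. Then there is a constant C, depending only on ζ and a, such that for every φ ∈ B₁ and every λ ∈ (0,ε]: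 |Λ(φ^λ)| ≤ C·K·ε^a; and if moreover ∫φ dz = 0, then |Λ(φ^λ)| ≤ C·K·λ·ε^{a−1}. -/
open MeasureTheory

/-- The set `B_R` of `C³` test functions supported in the parabolic ball of radius `R`
whose derivatives up to order `3` (including the function itself) are bounded by `1`. -/
def testB (R : ℝ) : Set ((Fin 4 → ℝ) → ℝ) :=
  {φ | ContDiff ℝ 3 φ ∧ (∀ z, R < pnorm z → φ z = 0) ∧
    ∀ n : ℕ, n ≤ 3 → ∀ z, ‖iteratedFDeriv ℝ n φ z‖ ≤ 1}

/-- A pair of compactly supported smooth functions dual to `1` and `x`. -/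
lemma exists_dual_bumps : ∃ b e : ℝ → ℝ, ContDiff ℝ 3 b ∧ ContDiff ℝ 3 e ∧
    (∀ x, 1 / 16 < |x| → b x = 0) ∧ (∀ x, 1 / 16 < |x| → e x = 0) ∧
    (∫ x, b x) = 1 ∧ (∫ x, b x * x) = 0 ∧ (∫ x, e x) = 0 ∧ (∫ x, e x * x) = 1 := by
  let c : ContDiffBump (0 : ℝ) := ⟨1 / 32, 1 / 16, by norm_num, by norm_num⟩
  set b : ℝ → ℝ := c.normed volume with hb
  have hbc : ContDiff ℝ 3 b := c.contDiff_normed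
  have hbs : ∀ x, 1 / 16 < |x| → b x = 0 := by
    intro x hx
    by_contra h
    have : x ∈ Function.support b := h
    rw [hb, c.support_normed_eq, Metric.mem_ball, dist_zero_right, Real.norm_eq_abs] at this
    exact absurd this (not_lt.2 hx.le)
  have hb1 : ∫ x, b x = 1 := c.integral_normed
  have hbx : ∫ x, b x * x = 0 := by
    have h := integral_neg_eq_self (fun x : ℝ => b x * x) volume
    have h2 : ∀ x : ℝ, b (-x) * (-x) = -(b x * x) := by
      intro x
      rw [hb, c.normed_neg]; ring
    simp only [h2, integral_neg] at h
    linarith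
  have hcs : HasCompactSupport (fun x : ℝ => b x * x * x) :=
    (c.hasCompactSupport_normed (μ := volume)).mul_right.mul_right
  have hpos : 0 < ∫ x, b x * x * x := by
    have hc : Continuous (fun x : ℝ => b x * x * x) := by
      have := hbc.continuous
      fun_prop
    refine hc.integral_pos_of_hasCompactSupport_nonneg_nonzero hcs (fun x => ?_) (x := 1 / 32) ?_
    · have := c.nonneg_normed (μ := volume) x
      simp only [Pi.zero_apply, mul_assoc]
      exact mul_nonneg this (mul_self_nonneg x)
    · have : (1 / 32 : ℝ) ∈ Function.support b := by
        rw [hb, c.support_normed_eq, Metric.mem_ball, dist_zero_right, Real.norm_eq_abs]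
        change |(1 / 32 : ℝ)| < 1 / 16
        rw [abs_of_pos] <;> norm_num
      have h3 : b (1 / 32) ≠ 0 := this
      simpa using h3
  refine ⟨b, fun x => (∫ x, b x * x * x)⁻¹ * (b x * x), hbc, by fun_prop, hbs, ?_, hb1, hbx, ?_, ?_⟩
  · intro x hx
    simp [hbs x hx]
  · rw [integral_const_mul, hbx, mul_zero]
  · simp only [mul_assoc]
    rw [integral_const_mul]
    simp only [mul_assoc] at hpos
    exact inv_mul_cancel₀ hpos.ne'

/-- A tensor product of functions of one variable. -/
def tensorFn (f : Fin 4 → ℝ → ℝ) (z : Fin 4 → ℝ) : ℝ := ∏ k, f k (z k)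

lemma integral_tensorFn (f : Fin 4 → ℝ → ℝ) : ∫ z, tensorFn f z = ∏ k, ∫ x, f k x :=
  integral_fintype_prod_volume_eq_prod f

lemma tensorFn_mul_coord (f : Fin 4 → ℝ → ℝ) (i : Fin 4) (z : Fin 4 → ℝ) :
    tensorFn f z * z i = tensorFn (Function.update f i (fun x => f i x * x)) z := by
  fin_cases i <;> simp [tensorFn, Fin.prod_univ_four, Function.update] <;> ring

lemma integral_tensorFn_mul_coord (f : Fin 4 → ℝ → ℝ) (i : Fin 4) :
    ∫ z, tensorFn f z * z i = ∏ k, ∫ x, Function.update f i (fun x => f i x * x) k x := by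
  simp only [tensorFn_mul_coord, integral_tensorFn]

lemma parRescale_two_tensorFn (f : Fin 4 → ℝ → ℝ) : parRescale 2 (tensorFn f) =
    fun z => (2 ^ 5 : ℝ)⁻¹ * tensorFn (fun k x => f k (x / if k = 0 then 4 else 2)) z := by
  ext z
  simp [parRescale, tensorFn, Fin.prod_univ_four]
  norm_num

lemma integral_comp_div_mul_id (g : ℝ → ℝ) {c : ℝ} (hc : 0 < c) :
    ∫ x, g (x / c) * x = c ^ 2 * ∫ x, g x * x := by
  have h := Measure.integral_comp_div (fun x => g x * x) c
  rw [abs_of_pos hc, smul_eq_mul] at h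
  have h2 : ∀ x, g (x / c) * x = c * (g (x / c) * (x / c)) := by
    intro x; field_simp
  simp only [h2]
  rw [integral_const_mul, h]; ring

lemma integral_parRescale_two_tensorFn (f : Fin 4 → ℝ → ℝ) :
    ∫ z, parRescale 2 (tensorFn f) z = ∫ z, tensorFn f z := by
  rw [parRescale_two_tensorFn, integral_const_mul, integral_tensorFn, integral_tensorFn]
  simp only [Measure.integral_comp_div]
  simp [Fin.prod_univ_four]
  ring

lemma integral_parRescale_two_tensorFn_mul_coord (f : Fin 4 → ℝ → ℝ) {i : Fin 4} (hi : i ≠ 0) :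
    ∫ z, parRescale 2 (tensorFn f) z * z i = 2 * ∫ z, tensorFn f z * z i := by
  simp only [parRescale_two_tensorFn, mul_assoc]
  rw [integral_const_mul, integral_tensorFn_mul_coord, integral_tensorFn_mul_coord]
  fin_cases i
  · exact absurd rfl hi
  all_goals
    simp [Fin.prod_univ_four, Function.update, Measure.integral_comp_div, integral_comp_div_mul_id]
    ring

lemma contDiff_tensorFn {f : Fin 4 → ℝ → ℝ} (hf : ∀ k, ContDiff ℝ 3 (f k)) :
    ContDiff ℝ 3 (tensorFn f) := by
  unfold tensorFn
  exact contDiff_prod fun k _ => (hf k).comp (contDiff_apply ℝ ℝ k)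

lemma tensorFn_eq_zero {f : Fin 4 → ℝ → ℝ} {r : ℝ} (hf : ∀ k x, r < |x| → f k x = 0)
    {z : Fin 4 → ℝ} {i : Fin 4} (hi : r < |z i|) : tensorFn f z = 0 :=
  Finset.prod_eq_zero (Finset.mem_univ i) (hf i _ hi)

lemma parRescale_two_eq_zero {g : (Fin 4 → ℝ) → ℝ} (hg : ∀ z i, 1 / 16 < |z i| → g z = 0)
    {z : Fin 4 → ℝ} {i : Fin 4} (hi : 1 / 4 < |z i|) : parRescale 2 g z = 0 := by
  unfold parRescale
  rw [hg _ i, mul_zero]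
  split_ifs with h
  · subst h
    rw [abs_div, abs_of_pos (by norm_num : (0 : ℝ) < 2 ^ 2)]
    linarith
  · rw [abs_div, abs_of_pos (by norm_num : (0 : ℝ) < 2)]
    linarith

lemma pnorm_le_one_of_abs_le {z : Fin 4 → ℝ} (hz : ∀ i, |z i| ≤ 1 / 4) : pnorm z ≤ 1 := by
  have h0 : Real.sqrt |z 0| ≤ 1 / 2 := by
    rw [Real.sqrt_le_left (by norm_num)]
    linarith [hz 0]
  have h1 : Real.sqrt ((z 1) ^ 2 + (z 2) ^ 2 + (z 3) ^ 2) ≤ 1 / 2 := by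
    rw [Real.sqrt_le_left (by norm_num)]
    have h : ∀ i, z i ^ 2 ≤ (1 / 4) ^ 2 := fun i => sq_le_sq.2 (by
      rw [abs_of_pos (by norm_num : (0 : ℝ) < 1 / 4)]; exact hz i)
    linarith [h 1, h 2, h 3]
  unfold pnorm
  linarith

lemma abs_le_one_of_pnorm_le_one {z : Fin 4 → ℝ} (hz : pnorm z ≤ 1) (i : Fin 4) : |z i| ≤ 1 := by
  unfold pnorm at hz
  have h0 := Real.sqrt_nonneg |z 0|
  have h1 := Real.sqrt_nonneg ((z 1) ^ 2 + (z 2) ^ 2 + (z 3) ^ 2)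
  have h2 : Real.sqrt |z 0| ≤ 1 := by linarith
  have h3 : Real.sqrt ((z 1) ^ 2 + (z 2) ^ 2 + (z 3) ^ 2) ≤ 1 := by linarith
  rw [Real.sqrt_le_one] at h2 h3
  have h4 := sq_nonneg (z 1)
  have h5 := sq_nonneg (z 2)
  have h6 := sq_nonneg (z 3)
  fin_cases i
  · exact h2
  all_goals
    refine (sq_le_one_iff_abs_le_one _).1 ?_
    simp only [Fin.mk_one, Fin.reduceFinMk]
    linarith

lemma parRescale_add (lam : ℝ) (f g : (Fin 4 → ℝ) → ℝ) :
    parRescale lam (f + g) = parRescale lam f + parRescale lam g := by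
  ext z; simp [parRescale, mul_add]

lemma parRescale_smul (lam c : ℝ) (f : (Fin 4 → ℝ) → ℝ) :
    parRescale lam (c • f) = c • parRescale lam f := by
  ext z; simp [parRescale, mul_left_comm]

lemma parRescale_parRescale_two (lam : ℝ) (f : (Fin 4 → ℝ) → ℝ) :
    parRescale lam (parRescale 2 f) = parRescale (2 * lam) f := by
  ext z
  have h : (fun i : Fin 4 => if i = 0 then (if (0 : Fin 4) = 0 then z 0 / lam ^ 2 else z 0 / lam) / 2 ^ 2
      else (if i = 0 then z 0 / lam ^ 2 else z i / lam) / 2) =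
      fun i => if i = 0 then z 0 / (2 * lam) ^ 2 else z i / (2 * lam) := by
    ext i
    split_ifs
    · rw [div_div]; ring_nf
    · simp_all
    · rw [div_div]; ring_nf
  unfold parRescale
  rw [h, ← mul_assoc, mul_pow 2 lam 5, mul_inv, mul_comm ((lam ^ 5)⁻¹)]

lemma contDiff_parRescale {g : (Fin 4 → ℝ) → ℝ} (hg : ContDiff ℝ 3 g) (lam : ℝ) :
    ContDiff ℝ 3 (parRescale lam g) := by
  unfold parRescale
  refine contDiff_const.mul (hg.comp (contDiff_pi.2 fun i => ?_))
  split_ifs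
  · exact (contDiff_apply ℝ ℝ 0).div_const _
  · exact (contDiff_apply ℝ ℝ i).div_const _

/-- A version of `testB` in which the derivatives are bounded by `M`. -/
def scaledTestB (R M : ℝ) : Set ((Fin 4 → ℝ) → ℝ) :=
  {φ | ContDiff ℝ 3 φ ∧ (∀ z, R < pnorm z → φ z = 0) ∧
    ∀ n : ℕ, n ≤ 3 → ∀ z, ‖iteratedFDeriv ℝ n φ z‖ ≤ M}

lemma scaledTestB_add {R M N : ℝ} {f g : (Fin 4 → ℝ) → ℝ} (hf : f ∈ scaledTestB R M)
    (hg : g ∈ scaledTestB R N) : f + g ∈ scaledTestB R (M + N) := by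
  refine ⟨hf.1.add hg.1, fun z hz => by simp [hf.2.1 z hz, hg.2.1 z hz], fun n hn z => ?_⟩
  have hn' : ((n : ℕ) : WithTop ℕ∞) ≤ 3 := by exact_mod_cast hn
  rw [iteratedFDeriv_add_apply (hf.1.of_le hn').contDiffAt (hg.1.of_le hn').contDiffAt]
  exact (norm_add_le _ _).trans (add_le_add (hf.2.2 n hn z) (hg.2.2 n hn z))

lemma scaledTestB_smul {R M : ℝ} {f : (Fin 4 → ℝ) → ℝ} (hf : f ∈ scaledTestB R M) (c : ℝ) :
    c • f ∈ scaledTestB R (|c| * M) := by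
  refine ⟨contDiff_const.smul hf.1, fun z hz => by simp [hf.2.1 z hz], fun n hn z => ?_⟩
  have hn' : ((n : ℕ) : WithTop ℕ∞) ≤ 3 := by exact_mod_cast hn
  rw [iteratedFDeriv_const_smul_apply (hf.1.of_le hn').contDiffAt, norm_smul, Real.norm_eq_abs]
  exact mul_le_mul_of_nonneg_left (hf.2.2 n hn z) (abs_nonneg c)

lemma scaledTestB_mono {R S M N : ℝ} (hR : R ≤ S) (hM : M ≤ N) :
    scaledTestB R M ⊆ scaledTestB S N := fun _ hf =>
  ⟨hf.1, fun z hz => hf.2.1 z (hR.trans_lt hz), fun n hn z => (hf.2.2 n hn z).trans hM⟩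

lemma inv_smul_mem_testB {R M : ℝ} (hM : 0 < M) {f : (Fin 4 → ℝ) → ℝ}
    (hf : f ∈ scaledTestB R M) : M⁻¹ • f ∈ testB R := by
  have h := scaledTestB_smul hf M⁻¹
  rw [abs_of_pos (inv_pos.2 hM), inv_mul_cancel₀ hM.ne'] at h
  exact h

lemma exists_mem_scaledTestB {g : (Fin 4 → ℝ) → ℝ} (hg : ContDiff ℝ 3 g)
    (hs : ∀ z i, 1 / 4 < |z i| → g z = 0) : ∃ M, 0 < M ∧ g ∈ scaledTestB 1 M := by
  have hcs : HasCompactSupport g := by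
    refine HasCompactSupport.intro (isCompact_closedBall (0 : Fin 4 → ℝ) (1 / 4)) fun z hz => ?_
    rw [mem_closedBall_zero_iff, pi_norm_le_iff_of_nonneg (by norm_num)] at hz
    push Not at hz
    obtain ⟨i, hi⟩ := hz
    exact hs z i hi
  have hb : ∀ n : ℕ, ∃ C, n ≤ 3 → ∀ z, ‖iteratedFDeriv ℝ n g z‖ ≤ C := by
    intro n
    by_cases hn : n ≤ 3
    · have hn' : ((n : ℕ) : WithTop ℕ∞) ≤ 3 := by exact_mod_cast hn
      obtain ⟨C, hC⟩ := (hcs.iteratedFDeriv (𝕜 := ℝ) n).exists_bound_of_continuous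
        (hg.continuous_iteratedFDeriv hn')
      exact ⟨C, fun _ => hC⟩
    · exact ⟨0, fun h => absurd h hn⟩
  choose C hC using hb
  refine ⟨1 + ∑ n ∈ Finset.range 4, |C n|, by positivity, hg, fun z hz => ?_, fun n hn z => ?_⟩
  · by_contra h
    refine absurd (pnorm_le_one_of_abs_le fun i => ?_) (not_le.2 hz)
    by_contra hi
    exact h (hs z i (not_le.1 hi))
  · have h1 := Finset.single_le_sum (f := fun n => |C n|) (fun i _ => abs_nonneg _)
      (Finset.mem_range.2 (by omega : n < 4))
    have h2 := hC n hn z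
    have h3 := le_abs_self (C n)
    linarith

lemma scaledTestB_add_smul {R M N : ℝ} {f g : (Fin 4 → ℝ) → ℝ} (hf : f ∈ scaledTestB R M)
    (hg : g ∈ scaledTestB R N) (c : ℝ) : f + c • g ∈ scaledTestB R (M + |c| * N) :=
  scaledTestB_add hf (scaledTestB_smul hg c)

lemma hasCompactSupport_of_mem_scaledTestB {M : ℝ} {f : (Fin 4 → ℝ) → ℝ}
    (hf : f ∈ scaledTestB 1 M) : HasCompactSupport f := by
  refine HasCompactSupport.intro (isCompact_closedBall (0 : Fin 4 → ℝ) 1) fun z hz => ?_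
  refine hf.2.1 z (not_le.1 fun h => hz ?_)
  rw [mem_closedBall_zero_iff, pi_norm_le_iff_of_nonneg zero_le_one]
  exact abs_le_one_of_pnorm_le_one h

lemma integrable_of_mem_scaledTestB {M : ℝ} {f : (Fin 4 → ℝ) → ℝ}
    (hf : f ∈ scaledTestB 1 M) : Integrable f :=
  hf.1.continuous.integrable_of_hasCompactSupport (hasCompactSupport_of_mem_scaledTestB hf)

lemma integrable_mul_coord_of_mem_scaledTestB {M : ℝ} {f : (Fin 4 → ℝ) → ℝ}
    (hf : f ∈ scaledTestB 1 M) (i : Fin 4) : Integrable (fun z => f z * z i) :=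
  (hf.1.continuous.mul (continuous_apply i)).integrable_of_hasCompactSupport
    (hasCompactSupport_of_mem_scaledTestB hf).mul_right

lemma integral_add_smul_of_mem_scaledTestB {M N : ℝ} {f g : (Fin 4 → ℝ) → ℝ}
    (hf : f ∈ scaledTestB 1 M) (hg : g ∈ scaledTestB 1 N) (c : ℝ) :
    ∫ z, (f + c • g) z = (∫ z, f z) + c * ∫ z, g z := by
  simp only [Pi.add_apply, Pi.smul_apply, smul_eq_mul]
  rw [integral_add (integrable_of_mem_scaledTestB hf)
    ((integrable_of_mem_scaledTestB hg).const_mul c), integral_const_mul]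

lemma integral_add_smul_mul_coord_of_mem_scaledTestB {M N : ℝ} {f g : (Fin 4 → ℝ) → ℝ}
    (hf : f ∈ scaledTestB 1 M) (hg : g ∈ scaledTestB 1 N) (c : ℝ) (i : Fin 4) :
    ∫ z, (f + c • g) z * z i = (∫ z, f z * z i) + c * ∫ z, g z * z i := by
  simp only [Pi.add_apply, Pi.smul_apply, smul_eq_mul, add_mul, mul_assoc]
  rw [integral_add (integrable_mul_coord_of_mem_scaledTestB hf i)
    ((integrable_mul_coord_of_mem_scaledTestB hg i).const_mul c), integral_const_mul]

lemma abs_integral_le_of_pnorm_le_one {f : (Fin 4 → ℝ) → ℝ} (hs : ∀ z, 1 < pnorm z → f z = 0)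
    (hb : ∀ z, pnorm z ≤ 1 → |f z| ≤ 1) : |∫ z, f z| ≤ 16 := by
  have hz : ∀ z ∉ Metric.closedBall (0 : Fin 4 → ℝ) 1, f z = 0 := fun z hz => by
    refine hs z (not_le.1 fun h => hz ?_)
    rw [mem_closedBall_zero_iff, pi_norm_le_iff_of_nonneg zero_le_one]
    exact abs_le_one_of_pnorm_le_one h
  have hv : volume.real (Metric.closedBall (0 : Fin 4 → ℝ) 1) = 16 := by
    rw [Measure.real, Real.volume_pi_closedBall _ zero_le_one]
    norm_num
  rw [← setIntegral_eq_integral_of_forall_compl_eq_zero hz, ← Real.norm_eq_abs]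
  refine (norm_setIntegral_le_of_norm_le_const (C := 1) measure_closedBall_lt_top
    fun z _ => ?_).trans_eq (by rw [hv, one_mul])
  by_cases h : pnorm z ≤ 1
  · exact hb z h
  · simp [hs z (not_le.1 h)]

lemma abs_le_one_of_mem_testB {R : ℝ} {φ : (Fin 4 → ℝ) → ℝ} (hφ : φ ∈ testB R)
    (z : Fin 4 → ℝ) : |φ z| ≤ 1 := by
  simpa using hφ.2.2 0 (by norm_num) z

lemma abs_integral_le_of_mem_testB {φ : (Fin 4 → ℝ) → ℝ} (hφ : φ ∈ testB 1) :
    |∫ z, φ z| ≤ 16 :=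
  abs_integral_le_of_pnorm_le_one hφ.2.1 fun z _ => abs_le_one_of_mem_testB hφ z

lemma abs_integral_mul_coord_le_of_mem_testB {φ : (Fin 4 → ℝ) → ℝ} (hφ : φ ∈ testB 1)
    (i : Fin 4) : |∫ z, φ z * z i| ≤ 16 :=
  abs_integral_le_of_pnorm_le_one (fun z hz => by simp [hφ.2.1 z hz]) fun z hz => by
    rw [abs_mul]
    exact mul_le_one₀ (abs_le_one_of_mem_testB hφ z) (abs_nonneg _)
      (abs_le_one_of_pnorm_le_one hz i)

/-- Summation of a recursive estimate over dyadic scales. -/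
lemma dyadic_bound {ζ ε A B : ℝ} {k : ℕ} (hk : (k : ℝ) < ζ) (hε : 0 < ε) (hA : 0 ≤ A)
    (hB : 0 ≤ B) {f : ℝ → ℝ}
    (h1 : ∀ l, 0 < l → l ≤ ε → f l ≤ (2 ^ k)⁻¹ * f (2 * l) + A * (l / ε) ^ ζ)
    (h2 : ∀ l, ε / 2 < l → l ≤ ε → f l ≤ B) {l : ℝ} (hl : 0 < l) (hlε : l ≤ ε) :
    f l ≤ (2 ^ k * B + A / (2 ^ (ζ - k) - 1)) * (l / ε) ^ k := by
  have hpos : 0 < (2 : ℝ) ^ (ζ - k) - 1 :=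
    sub_pos.2 (Real.one_lt_rpow (by norm_num) (sub_pos.2 hk))
  set D := A / ((2 : ℝ) ^ (ζ - k) - 1) with hD
  have hD0 : 0 ≤ D := div_nonneg hA hpos.le
  have hDA : D * (2 : ℝ) ^ (ζ - k) = A + D := by
    have : D * ((2 : ℝ) ^ (ζ - k) - 1) = A := div_mul_cancel₀ _ hpos.ne'
    linarith
  have base : ∀ l, ε / 2 < l → l ≤ ε →
      f l ≤ (2 ^ k * B + D) * (l / ε) ^ k - D * (l / ε) ^ ζ := by
    intro l hl hlε
    have hu : 1 ≤ 2 * (l / ε) := by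
      rw [← mul_div_assoc, one_le_div hε]; linarith
    have hu0 : 0 < l / ε := by linarith
    have hu1 : l / ε ≤ 1 := (div_le_one hε).2 hlε
    have e1 : (l / ε) ^ ζ ≤ (l / ε) ^ k := by
      rw [← Real.rpow_natCast]
      exact Real.rpow_le_rpow_of_exponent_ge hu0 hu1 hk.le
    have e2 : 1 ≤ 2 ^ k * (l / ε) ^ k := by
      rw [← mul_pow]; exact one_le_pow₀ hu
    nlinarith [h2 l hl hlε, mul_le_mul_of_nonneg_left e1 hD0, mul_le_mul_of_nonneg_left e2 hB]
  have main : ∀ n : ℕ, ∀ l, 0 < l → ε < 2 ^ n * (2 * l) → l ≤ ε →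
      f l ≤ (2 ^ k * B + D) * (l / ε) ^ k - D * (l / ε) ^ ζ := by
    intro n
    induction n with
    | zero => exact fun l _ hl hlε => base l (by linarith) hlε
    | succ n ih =>
      intro l hl0 hl hlε
      rcases lt_or_ge (ε / 2) l with h | h
      · exact base l h hlε
      have hi := ih (2 * l) (by linarith) (by rw [pow_succ] at hl; linarith) (by linarith)
      have hu0 : 0 < l / ε := div_pos hl0 hε
      rw [mul_div_assoc, mul_pow, Real.mul_rpow (by norm_num) hu0.le] at hi
      have e : (2 : ℝ) ^ ζ = 2 ^ k * 2 ^ (ζ - k) := by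
        rw [← Real.rpow_natCast, ← Real.rpow_add (by norm_num)]; ring_nf
      have hk0 : (0 : ℝ) < 2 ^ k := by positivity
      rw [e] at hi
      calc f l ≤ (2 ^ k)⁻¹ * f (2 * l) + A * (l / ε) ^ ζ := h1 l hl0 hlε
        _ ≤ (2 ^ k)⁻¹ * ((2 ^ k * B + D) * (2 ^ k * (l / ε) ^ k) -
              D * (2 ^ k * 2 ^ (ζ - k) * (l / ε) ^ ζ)) + A * (l / ε) ^ ζ := by gcongr
        _ = (2 ^ k * B + D) * (l / ε) ^ k -
              (D * 2 ^ (ζ - k)) * (l / ε) ^ ζ + A * (l / ε) ^ ζ := by field_simp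
        _ = _ := by rw [hDA]; ring
  obtain ⟨n, hn⟩ := pow_unbounded_of_one_lt (ε / (2 * l)) (one_lt_two (α := ℝ))
  have := main n l hl ((div_lt_iff₀ (by linarith)).1 hn) hlε
  have h3 : 0 ≤ D * (l / ε) ^ ζ := mul_nonneg hD0 (Real.rpow_nonneg (div_pos hl hε).le _)
  linarith

/-- The `ε`-model bound together with the standard model bound. -/
structure ModelBounds (ζ a ε K : ℝ) (Λ : ((Fin 4 → ℝ) → ℝ) →ₗ[ℝ] ℝ) : Prop where
  annihilating : ∀ ψ ∈ testB 2, (∫ z, ψ z) = 0 →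
    (∀ i : Fin 4, i ≠ 0 → (∫ z, ψ z * z i) = 0) →
    ∀ lam : ℝ, 0 < lam → lam ≤ ε → |Λ (parRescale lam ψ)| ≤ K * lam ^ ζ * ε ^ (a - ζ)
  standard : ∀ φ ∈ testB 2, ∀ lam : ℝ, 0 < lam → lam ≤ 1 →
    |Λ (parRescale lam φ)| ≤ K * lam ^ a

lemma abs_parRescale_eq {M : ℝ} (hM : 0 < M) (Λ : ((Fin 4 → ℝ) → ℝ) →ₗ[ℝ] ℝ) (lam : ℝ)
    (ψ : (Fin 4 → ℝ) → ℝ) :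
    |Λ (parRescale lam ψ)| = M * |Λ (parRescale lam (M⁻¹ • ψ))| := by
  rw [parRescale_smul, map_smul, smul_eq_mul, abs_mul, abs_of_pos (inv_pos.2 hM),
    mul_inv_cancel_left₀ hM.ne']

lemma ModelBounds.abs_le_of_annihilating {ζ a ε K : ℝ} {Λ : ((Fin 4 → ℝ) → ℝ) →ₗ[ℝ] ℝ}
    (h : ModelBounds ζ a ε K Λ) (hε : 0 < ε) {M : ℝ} (hM : 0 < M) {ψ : (Fin 4 → ℝ) → ℝ}
    (hψ : ψ ∈ scaledTestB 2 M) (h0 : ∫ z, ψ z = 0)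
    (hi : ∀ i : Fin 4, i ≠ 0 → ∫ z, ψ z * z i = 0) {lam : ℝ} (hl : 0 < lam) (hlε : lam ≤ ε) :
    |Λ (parRescale lam ψ)| ≤ M * (K * ε ^ a) * (lam / ε) ^ ζ := by
  have := h.annihilating (M⁻¹ • ψ) (inv_smul_mem_testB hM hψ)
    (by simp only [Pi.smul_apply, smul_eq_mul]; rw [integral_const_mul, h0, mul_zero])
    (fun i hi0 => by
      simp only [Pi.smul_apply, smul_eq_mul, mul_assoc]
      rw [integral_const_mul, hi i hi0, mul_zero]) lam hl hlε
  rw [abs_parRescale_eq hM, mul_assoc]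
  refine mul_le_mul_of_nonneg_left (this.trans_eq ?_) hM.le
  rw [Real.div_rpow hl.le hε.le, Real.rpow_sub hε]
  ring

lemma ModelBounds.abs_le_of_half_lt {ζ a ε K : ℝ} {Λ : ((Fin 4 → ℝ) → ℝ) →ₗ[ℝ] ℝ}
    (h : ModelBounds ζ a ε K Λ) (hε : 0 < ε) (hε1 : ε < 1) (hK : 0 ≤ K) {M : ℝ} (hM : 0 < M)
    {φ : (Fin 4 → ℝ) → ℝ} (hφ : φ ∈ scaledTestB 2 M) {lam : ℝ} (hl : ε / 2 < lam)
    (hlε : lam ≤ ε) : |Λ (parRescale lam φ)| ≤ M * 2 ^ |a| * (K * ε ^ a) := by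
  have hl0 : 0 < lam := by linarith
  have := h.standard _ (inv_smul_mem_testB hM hφ) lam hl0 (by linarith)
  have hle : lam ^ a ≤ 2 ^ |a| * ε ^ a := by
    rw [← div_le_iff₀ (Real.rpow_pos_of_pos hε a), ← Real.div_rpow hl0.le hε.le]
    have hu1 : lam / ε ≤ 1 := (div_le_one hε).2 hlε
    have hu0 : 0 < lam / ε := div_pos hl0 hε
    have hu2 : (lam / ε)⁻¹ ≤ 2 := by
      rw [inv_div, div_le_iff₀ hl0]; linarith
    calc (lam / ε) ^ a ≤ (lam / ε) ^ (-|a|) :=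
          Real.rpow_le_rpow_of_exponent_ge hu0 hu1 (neg_abs_le a)
      _ = ((lam / ε)⁻¹) ^ |a| := by rw [Real.rpow_neg hu0.le, Real.inv_rpow hu0.le]
      _ ≤ 2 ^ |a| := Real.rpow_le_rpow (inv_pos.2 hu0).le hu2 (abs_nonneg a)
  rw [abs_parRescale_eq hM, mul_assoc]
  refine mul_le_mul_of_nonneg_left (this.trans ?_) hM.le
  calc K * lam ^ a ≤ K * (2 ^ |a| * ε ^ a) := mul_le_mul_of_nonneg_left hle hK
    _ = _ := by ring

/-- If doubling the scale multiplies the affine moments of `g` by `2 ^ k`, then the model bounds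
control `g` at every scale `lam ≤ ε` by `(lam / ε) ^ k`. -/
lemma exists_bound_of_homogeneous_moments {ζ : ℝ} (a : ℝ) {k : ℕ} (hk : (k : ℝ) < ζ)
    {g : (Fin 4 → ℝ) → ℝ} (hg : ContDiff ℝ 3 g) (hs : ∀ z i, 1 / 16 < |z i| → g z = 0)
    (h0 : ∫ z, parRescale 2 g z = 2 ^ k * ∫ z, g z)
    (hi : ∀ i : Fin 4, i ≠ 0 → ∫ z, parRescale 2 g z * z i = 2 ^ k * ∫ z, g z * z i) :
    ∃ C, 0 ≤ C ∧ ∀ (ε K : ℝ), 0 < ε → ε < 1 → 0 ≤ K → ∀ Λ, ModelBounds ζ a ε K Λ →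
      ∀ lam : ℝ, 0 < lam → lam ≤ ε →
        |Λ (parRescale lam g)| ≤ C * (K * ε ^ a) * (lam / ε) ^ k := by
  obtain ⟨M, hM, hgM⟩ := exists_mem_scaledTestB hg fun z i h => hs z i (by linarith)
  obtain ⟨N, hN, hgN⟩ := exists_mem_scaledTestB (contDiff_parRescale hg 2)
    fun z i h => parRescale_two_eq_zero hs h
  have hk0 : (2 : ℝ) ^ k ≠ 0 := by positivity
  set ψ := g + (-(2 ^ k)⁻¹ : ℝ) • parRescale 2 g with hψ
  set L := M + |(-(2 ^ k)⁻¹ : ℝ)| * N with hL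
  have hL0 : 0 < L := by positivity
  have hψL : ψ ∈ scaledTestB 2 L :=
    scaledTestB_mono one_le_two le_rfl (scaledTestB_add_smul hgM hgN _)
  have hψ0 : ∫ z, ψ z = 0 := by
    rw [hψ, integral_add_smul_of_mem_scaledTestB hgM hgN, h0]
    field_simp
    ring
  have hψi : ∀ i : Fin 4, i ≠ 0 → ∫ z, ψ z * z i = 0 := fun i hi0 => by
    rw [hψ, integral_add_smul_mul_coord_of_mem_scaledTestB hgM hgN, hi i hi0]
    field_simp
    ring
  have hd : 0 < (2 : ℝ) ^ (ζ - k) - 1 :=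
    sub_pos.2 (Real.one_lt_rpow (by norm_num) (sub_pos.2 hk))
  refine ⟨2 ^ k * (M * 2 ^ |a|) + L / (2 ^ (ζ - k) - 1), by positivity, ?_⟩
  intro ε K hε hε1 hK Λ hΛ lam hl hlε
  have hX : 0 ≤ K * ε ^ a := by positivity
  have h := dyadic_bound (f := fun l => |Λ (parRescale l g)|) (A := L * (K * ε ^ a))
    (B := M * 2 ^ |a| * (K * ε ^ a)) hk hε (by positivity) (by positivity) ?_ ?_ hl hlε
  · refine h.trans_eq ?_
    ring
  · intro l hl hlε
    have hb := hΛ.abs_le_of_annihilating hε hL0 hψL hψ0 hψi hl hlε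
    have hg' : Λ (parRescale l g) =
        Λ (parRescale l ψ) + (2 ^ k)⁻¹ * Λ (parRescale (2 * l) g) := by
      rw [hψ, parRescale_add, parRescale_smul, parRescale_parRescale_two, map_add, map_smul,
        smul_eq_mul]
      ring
    have h3 := abs_add_le (Λ (parRescale l ψ)) ((2 ^ k)⁻¹ * Λ (parRescale (2 * l) g))
    rw [abs_mul, abs_of_pos (by positivity : (0 : ℝ) < (2 ^ k)⁻¹)] at h3
    simp only [hg']
    linarith
  · intro l hl hlε
    exact hΛ.abs_le_of_half_lt hε hε1 hK hM (scaledTestB_mono one_le_two le_rfl hgM) hl hlε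

/-- Implied model bounds: if a linear functional `Λ` satisfies the `ε`-model bound
`|Λ(ψ^λ)| ≤ K λ^ζ ε^{a−ζ}` (for `λ ≤ ε` and test functions `ψ` annihilating affine
functions of the spatial variable) and the standard bound `|Λ(φ^λ)| ≤ K λ^a`, then there
is `C = C(ζ,a)` such that for `φ ∈ B₁` and `λ ≤ ε` one has `|Λ(φ^λ)| ≤ C K ε^a`, and
moreover `|Λ(φ^λ)| ≤ C K λ ε^{a−1}` whenever `∫ φ = 0`. -/
theorem stmt_16 (ζ a : ℝ) (hζ1 : 1 < ζ) (hζ2 : ζ < 2) :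
    ∃ C : ℝ, ∀ (ε K : ℝ), 0 < ε → ε < 1 → 0 ≤ K →
      ∀ Λ : ((Fin 4 → ℝ) → ℝ) →ₗ[ℝ] ℝ,
        (∀ ψ ∈ testB 2, (∫ z, ψ z) = 0 → (∀ i : Fin 4, i ≠ 0 → (∫ z, ψ z * z i) = 0) →
          ∀ lam : ℝ, 0 < lam → lam ≤ ε →
            |Λ (parRescale lam ψ)| ≤ K * lam ^ ζ * ε ^ (a - ζ)) →
        (∀ φ ∈ testB 2, ∀ lam : ℝ, 0 < lam → lam ≤ 1 →
          |Λ (parRescale lam φ)| ≤ K * lam ^ a) →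
        ∀ φ ∈ testB 1, ∀ lam : ℝ, 0 < lam → lam ≤ ε →
          (|Λ (parRescale lam φ)| ≤ C * K * ε ^ a ∧
           ((∫ z, φ z) = 0 → |Λ (parRescale lam φ)| ≤ C * K * lam * ε ^ (a - 1))) := by
  obtain ⟨b, e, hb, he, hbs, hes, hb0, hb1, he0, he1⟩ := exists_dual_bumps
  set ρ : (Fin 4 → ℝ) → ℝ := tensorFn fun _ => b with hρ
  set η : Fin 4 → (Fin 4 → ℝ) → ℝ := fun i => tensorFn (Function.update (fun _ => b) i e) with hη
  have hρc : ContDiff ℝ 3 ρ := contDiff_tensorFn fun _ => hb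
  have hρs : ∀ z i, 1 / 16 < |z i| → ρ z = 0 := fun z i h => tensorFn_eq_zero (fun _ => hbs) h
  have hηc : ∀ i, ContDiff ℝ 3 (η i) := fun i => contDiff_tensorFn fun k => by
    rcases eq_or_ne k i with rfl | h
    · simpa using he
    · simpa [h] using hb
  have hηs : ∀ i z j, 1 / 16 < |z j| → η i z = 0 := fun i z j h =>
    tensorFn_eq_zero (fun k => by
      rcases eq_or_ne k i with rfl | h
      · simpa using hes
      · simpa [h] using hbs) h
  have hρ0 : ∫ z, ρ z = 1 := by simp [hρ, integral_tensorFn, hb0]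
  have hρi : ∀ i, ∫ z, ρ z * z i = 0 := fun i => by
    rw [hρ, integral_tensorFn_mul_coord]
    exact Finset.prod_eq_zero (Finset.mem_univ i) (by simpa using hb1)
  have hη0 : ∀ i, ∫ z, η i z = 0 := fun i => by
    rw [hη, integral_tensorFn]
    exact Finset.prod_eq_zero (Finset.mem_univ i) (by simpa using he0)
  have hηi : ∀ i j, ∫ z, η i z * z j = if i = j then 1 else 0 := fun i j => by
    simp only [hη]
    rw [integral_tensorFn_mul_coord]
    split_ifs with h
    · subst h
      refine Finset.prod_eq_one fun k _ => ?_
      rcases eq_or_ne k i with rfl | h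
      · simpa using he1
      · simpa [h] using hb0
    · refine Finset.prod_eq_zero (Finset.mem_univ i) ?_
      simpa [h] using he0
  obtain ⟨M, hM, hρM⟩ := exists_mem_scaledTestB hρc fun z i h => hρs z i (by linarith)
  have hηM := fun i => exists_mem_scaledTestB (hηc i) fun z j h => hηs i z j (by linarith)
  choose N hN hηN using hηM
  obtain ⟨Cρ, hCρ, hCρb⟩ := exists_bound_of_homogeneous_moments (ζ := ζ) a (k := 0)
    (by push_cast; linarith) hρc hρs (by rw [hρ, integral_parRescale_two_tensorFn]; ring)
    (fun i hi => by
      rw [hρ, integral_parRescale_two_tensorFn_mul_coord _ hi, ← hρ, hρi]; ring)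
  have hCη := fun i => exists_bound_of_homogeneous_moments (ζ := ζ) a (k := 1)
    (by push_cast; linarith) (hηc i) (hηs i)
    (by
      have := hη0 i
      simp only [hη] at this ⊢
      rw [integral_parRescale_two_tensorFn, this]; ring)
    (fun j hj => by
      simp only [hη]
      rw [integral_parRescale_two_tensorFn_mul_coord _ hj]; ring)
  choose Cη hCη hCηb using hCη
  set L := 1 + 16 * M + 16 * N 1 + 16 * N 2 + 16 * N 3 with hL
  have hL0 : 0 < L := by linarith [hN 1, hN 2, hN 3]
  set C' := 16 * (Cη 1 + Cη 2 + Cη 3) with hC'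
  have hC'0 : 0 ≤ C' := by linarith [hCη 1, hCη 2, hCη 3]
  refine ⟨L + 16 * Cρ + C', ?_⟩
  intro ε K hε hε1 hK Λ hi hii φ hφ lam hl hlε
  have hΛ : ModelBounds ζ a ε K Λ := ⟨hi, hii⟩
  set m := ∫ z, φ z with hm
  set p : Fin 4 → ℝ := fun i => ∫ z, φ z * z i with hp
  have hm16 : |m| ≤ 16 := abs_integral_le_of_mem_testB hφ
  have hp16 : ∀ i, |p i| ≤ 16 := abs_integral_mul_coord_le_of_mem_testB hφ
  have hφ1 : φ ∈ scaledTestB 1 1 := hφ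
  have m1 := scaledTestB_add_smul hφ1 hρM (-m)
  have m2 := scaledTestB_add_smul m1 (hηN 1) (-p 1)
  have m3 := scaledTestB_add_smul m2 (hηN 2) (-p 2)
  have m4 := scaledTestB_add_smul m3 (hηN 3) (-p 3)
  set ψ := φ + (-m) • ρ + (-p 1) • η 1 + (-p 2) • η 2 + (-p 3) • η 3 with hψ
  have hψL : ψ ∈ scaledTestB 2 L := by
    refine scaledTestB_mono one_le_two ?_ m4
    simp only [abs_neg]
    have := mul_le_mul_of_nonneg_right hm16 hM.le
    have := fun i => mul_le_mul_of_nonneg_right (hp16 i) (hN i).le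
    linarith [this 1, this 2, this 3]
  have hψ0 : ∫ z, ψ z = 0 := by
    rw [hψ, integral_add_smul_of_mem_scaledTestB m3 (hηN 3),
      integral_add_smul_of_mem_scaledTestB m2 (hηN 2),
      integral_add_smul_of_mem_scaledTestB m1 (hηN 1),
      integral_add_smul_of_mem_scaledTestB hφ1 hρM, hρ0, hη0, hη0, hη0]
    ring
  have hψi : ∀ i : Fin 4, i ≠ 0 → ∫ z, ψ z * z i = 0 := fun i hi0 => by
    rw [hψ, integral_add_smul_mul_coord_of_mem_scaledTestB m3 (hηN 3),
      integral_add_smul_mul_coord_of_mem_scaledTestB m2 (hηN 2),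
      integral_add_smul_mul_coord_of_mem_scaledTestB m1 (hηN 1),
      integral_add_smul_mul_coord_of_mem_scaledTestB hφ1 hρM, hρi, hηi, hηi, hηi]
    fin_cases i
    · exact absurd rfl hi0
    all_goals simp [hp]
  have hdec : Λ (parRescale lam φ) = Λ (parRescale lam ψ) + m * Λ (parRescale lam ρ) +
      p 1 * Λ (parRescale lam (η 1)) + p 2 * Λ (parRescale lam (η 2)) +
      p 3 * Λ (parRescale lam (η 3)) := by
    simp only [hψ, parRescale_add, parRescale_smul, map_add, map_smul, smul_eq_mul]
    ring
  set X := K * ε ^ a with hX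
  have hX0 : 0 ≤ X := by positivity
  set u := lam / ε with hu
  have hu0 : 0 < u := div_pos hl hε
  have hu1 : u ≤ 1 := (div_le_one hε).2 hlε
  have huζ : u ^ ζ ≤ u := by
    simpa using Real.rpow_le_rpow_of_exponent_ge hu0 hu1 hζ1.le
  have hbψ : |Λ (parRescale lam ψ)| ≤ L * X * u :=
    (hΛ.abs_le_of_annihilating hε hL0 hψL hψ0 hψi hl hlε).trans
      (mul_le_mul_of_nonneg_left huζ (by positivity))
  have hbρ : |Λ (parRescale lam ρ)| ≤ Cρ * X := by
    simpa using hCρb ε K hε hε1 hK Λ hΛ lam hl hlε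
  have hbη : ∀ i, |p i * Λ (parRescale lam (η i))| ≤ 16 * (Cη i * X * u) := fun i => by
    rw [abs_mul]
    refine mul_le_mul (hp16 i) ?_ (abs_nonneg _) (by norm_num)
    simpa using hCηb i ε K hε hε1 hK Λ hΛ lam hl hlε
  have key : |Λ (parRescale lam φ)| ≤ (L + C') * X * u + |m| * (Cρ * X) := by
    rw [hdec]
    have a1 := abs_add_le (Λ (parRescale lam ψ) + m * Λ (parRescale lam ρ) +
      p 1 * Λ (parRescale lam (η 1)) + p 2 * Λ (parRescale lam (η 2)))
      (p 3 * Λ (parRescale lam (η 3)))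
    have a2 := abs_add_le (Λ (parRescale lam ψ) + m * Λ (parRescale lam ρ) +
      p 1 * Λ (parRescale lam (η 1))) (p 2 * Λ (parRescale lam (η 2)))
    have a3 := abs_add_le (Λ (parRescale lam ψ) + m * Λ (parRescale lam ρ))
      (p 1 * Λ (parRescale lam (η 1)))
    have a4 := abs_add_le (Λ (parRescale lam ψ)) (m * Λ (parRescale lam ρ))
    rw [abs_mul m] at a4
    have a5 := mul_le_mul_of_nonneg_left hbρ (abs_nonneg m)
    rw [hC']
    linarith [hbη 1, hbη 2, hbη 3]
  have hLX : 0 ≤ (L + C') * X := by positivity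
  refine ⟨?_, fun hm0 => ?_⟩
  · have b1 := mul_le_mul_of_nonneg_left hu1 hLX
    have b2 := mul_le_mul_of_nonneg_right hm16 (mul_nonneg hCρ hX0)
    calc |Λ (parRescale lam φ)| ≤ (L + 16 * Cρ + C') * X := by linarith
      _ = _ := by rw [hX]; ring
  · rw [hm0, abs_zero, zero_mul, add_zero] at key
    have b3 : 0 ≤ Cρ * X * u := by positivity
    calc |Λ (parRescale lam φ)| ≤ (L + 16 * Cρ + C') * X * u := by linarith
      _ = _ := by rw [hX, hu, Real.rpow_sub_one hε.ne']; ring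
end
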